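/- arXiv:math/0404299 — 2 statements merged into one kernel-verified Lean document; each statement's English description precedes it below -/
import Mathlib

section
/- Fix β>0 and ε>0, and let R(β,ε) be the neutral set. Then there exist a(β,ε)≥0, which is >0 if β>1 and =0 if β≤1, and a continuous strictly increasing function l_{β,ε} defined on the open interval (a(β,ε),∞) taking positive values, such that, setting R⁺(β,ε) = {(h₀, −l_{β,ε}(h₀)) : h₀∈(a(β,ε),∞)}, one has: R(β,ε) = R⁺(β,ε) ∪ (−R⁺(β,ε)) when β>1, and R(β,ε) = R⁺(β,ε) ∪ (−R⁺(β,ε)) ∪ {(0,0)} with lim_{h₀↓0} l_{β,ε}(h₀)=0 when β≤1. Consequently, as a subset of ℝ², R(β,ε) is disconnected if β>1 and connected if β≤1. -/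
open Real Filter MeasureTheory
open scoped Classical BigOperators

noncomputable section

/-- Map a Boolean to a ±1 spin value. -/
def spin (b : Bool) : ℝ := if b then 1 else -1

/-- Hamiltonian (with sign absorbed) of the Morita approximant measure. -/
def morH (N : ℕ) (β ε h₀ lam : ℝ) (σ η : Fin N → Bool) : ℝ :=
  β / (2 * N) * (∑ i, spin (σ i)) ^ 2
    + β * ∑ i, (ε * spin (η i) + h₀) * spin (σ i)
    + lam * ∑ i, spin (η i)

/-- Partition function of the Morita approximant measure. -/
def morZ (N : ℕ) (β ε h₀ lam : ℝ) : ℝ :=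
  ∑ σ : Fin N → Bool, ∑ η : Fin N → Bool, Real.exp (morH N β ε h₀ lam σ η)

/-- The Morita approximant measure on pairs of configurations. -/
def morK (N : ℕ) (β ε h₀ lam : ℝ) (σ η : Fin N → Bool) : ℝ :=
  Real.exp (morH N β ε h₀ lam σ η) / morZ N β ε h₀ lam

/-- Probability under the Morita approximant measure that the first `N₀`
random-field variables agree with `ηbar`. -/
def etaCylProb (N₀ N : ℕ) (β ε h₀ lam : ℝ) (ηbar : Fin N₀ → Bool) : ℝ :=
  ∑ σ : Fin N → Bool, ∑ η : Fin N → Bool,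
    if ∀ (i : Fin N₀) (h : (i : ℕ) < N), η ⟨i, h⟩ = ηbar i
    then morK N β ε h₀ lam σ η else 0

/-- `(h₀, lam)` is neutral: the η-marginal of the Morita approximant measures
converges weakly to the symmetric i.i.d. field distribution. -/
def IsNeutral (β ε h₀ lam : ℝ) : Prop :=
  ∀ (N₀ : ℕ) (ηbar : Fin N₀ → Bool),
    Tendsto (fun N => etaCylProb N₀ N β ε h₀ lam ηbar) atTop (nhds ((2 : ℝ)⁻¹ ^ N₀))

def pE (β ε h lam y : ℝ) (s b : Bool) : ℝ :=
  Real.exp (-β * y ^ 2 / 2 + β * (y + h + ε * spin b) * spin s + lam * spin b)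

def pA (β ε h lam y : ℝ) (b : Bool) : ℝ := ∑ s : Bool, pE β ε h lam y s b

def pW (β ε h lam y : ℝ) : ℝ := ∑ b : Bool, pA β ε h lam y b

lemma hs_aux (c M y : ℝ) (β : ℝ) (hc : 0 < c) :
    -(c * β) * y ^ 2 / 2 + β * y * M
      = -(c * β / 2) * (y - M / c) ^ 2 + β / (2 * c) * M ^ 2 := by
  field_simp
  ring

lemma hs_integrable (c M β : ℝ) (hc : 0 < c) (hβ : 0 < β) :
    Integrable (fun y : ℝ => Real.exp (-(c * β) * y ^ 2 / 2 + β * y * M)) := by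
  have h1 : Integrable (fun y : ℝ => Real.exp (-(c * β / 2) * y ^ 2)) :=
    integrable_exp_neg_mul_sq (by positivity)
  have h2 := (h1.comp_sub_right (M / c)).mul_const (Real.exp (β / (2 * c) * M ^ 2))
  refine h2.congr (Eventually.of_forall fun y => ?_)
  simp only
  rw [← Real.exp_add, hs_aux c M y β hc]

lemma hs_integral (c M β : ℝ) (hc : 0 < c) :
    ∫ y : ℝ, Real.exp (-(c * β) * y ^ 2 / 2 + β * y * M)
      = √(π / (c * β / 2)) * Real.exp (β / (2 * c) * M ^ 2) := by
  have : (fun y : ℝ => Real.exp (-(c * β) * y ^ 2 / 2 + β * y * M))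
      = fun y => Real.exp (-(c * β / 2) * (y - M / c) ^ 2) * Real.exp (β / (2 * c) * M ^ 2) := by
    funext y
    rw [← Real.exp_add, hs_aux c M y β hc]
  rw [this, integral_mul_const, integral_sub_right_eq_self
    (fun y => Real.exp (-(c * β / 2) * y ^ 2)) (M / c), integral_gaussian]

lemma prod_pE (N : ℕ) (β ε h lam y : ℝ) (σ η : Fin N → Bool) :
    ∏ i, pE β ε h lam y (σ i) (η i)
      = Real.exp (-((N : ℝ) * β) * y ^ 2 / 2 + β * y * ∑ i, spin (σ i)) *
        Real.exp (β * ∑ i, (ε * spin (η i) + h) * spin (σ i) + lam * ∑ i, spin (η i)) := by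
  unfold pE
  rw [← Real.exp_sum, ← Real.exp_add]
  congr 1
  have : ∀ i, -β * y ^ 2 / 2 + β * (y + h + ε * spin (η i)) * spin (σ i) + lam * spin (η i)
    = -β * y ^ 2 / 2 + β * y * spin (σ i) + β * ((ε * spin (η i) + h) * spin (σ i))
      + lam * spin (η i) := fun i => by ring
  simp only [this, Finset.sum_add_distrib, ← Finset.mul_sum, Finset.sum_const, Finset.card_univ,
    Fintype.card_fin, nsmul_eq_mul]
  ring

lemma sum_formula (N : ℕ) (hN : 0 < N) (β ε h lam : ℝ) (hβ : 0 < β) (G : Fin N → Bool → ℝ) :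
    ∫ y : ℝ, ∏ i, ∑ b, G i b * pA β ε h lam y b
      = √(π / ((N : ℝ) * β / 2)) *
        ∑ σ : Fin N → Bool, ∑ η : Fin N → Bool,
          (∏ i, G i (η i)) * Real.exp (morH N β ε h lam σ η) := by
  have hN' : (0 : ℝ) < N := by exact_mod_cast hN
  have e1 : ∀ y : ℝ, ∏ i, ∑ b, G i b * pA β ε h lam y b
      = ∑ σ : Fin N → Bool, ∑ η : Fin N → Bool,
        Real.exp (-((N : ℝ) * β) * y ^ 2 / 2 + β * y * ∑ i, spin (σ i)) *
        ((∏ i, G i (η i)) *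
        Real.exp (β * ∑ i, (ε * spin (η i) + h) * spin (σ i) + lam * ∑ i, spin (η i))) := by
    intro y
    have : ∀ i, ∑ b, G i b * pA β ε h lam y b
        = ∑ s : Bool, ∑ b : Bool, G i b * pE β ε h lam y s b := by
      intro i
      rw [Finset.sum_comm]
      simp only [pA, Finset.mul_sum]
    simp only [this]
    rw [Fintype.prod_sum]
    refine Finset.sum_congr rfl fun σ _ => ?_
    rw [Fintype.prod_sum]
    refine Finset.sum_congr rfl fun η _ => ?_
    rw [Finset.prod_mul_distrib, prod_pE]
    ring
  simp only [e1]
  have hi : ∀ (σ η : Fin N → Bool), Integrable (fun y : ℝ =>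
      Real.exp (-((N : ℝ) * β) * y ^ 2 / 2 + β * y * ∑ i, spin (σ i)) *
        ((∏ i, G i (η i)) *
        Real.exp (β * ∑ i, (ε * spin (η i) + h) * spin (σ i) + lam * ∑ i, spin (η i)))) :=
    fun σ η => (hs_integrable _ _ β hN' hβ).mul_const _
  rw [integral_finsetSum _ fun σ _ => integrable_finsetSum _ fun η _ => hi σ η, Finset.mul_sum]
  refine Finset.sum_congr rfl fun σ _ => ?_
  rw [integral_finsetSum _ fun η _ => hi σ η, Finset.mul_sum]
  refine Finset.sum_congr rfl fun η _ => ?_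
  rw [integral_mul_const, hs_integral _ _ _ hN', morH]
  simp only [Real.exp_add]
  ring

lemma cyl_formula (N₀ n : ℕ) (hN : 0 < N₀ + n) (β ε h lam : ℝ) (hβ : 0 < β) (ηbar : Fin N₀ → Bool) :
    etaCylProb N₀ (N₀ + n) β ε h lam ηbar
      = (∫ y : ℝ, (∏ i, pA β ε h lam y (ηbar i)) * pW β ε h lam y ^ n) /
        ∫ y : ℝ, pW β ε h lam y ^ (N₀ + n) := by
  have hN' : (0 : ℝ) < ((N₀ + n : ℕ) : ℝ) := by exact_mod_cast hN
  have hC : √(π / (((N₀ + n : ℕ) : ℝ) * β / 2)) ≠ 0 := by positivity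
  have hZ := sum_formula (N₀ + n) hN β ε h lam hβ (fun _ _ => 1)
  simp only [one_mul, Finset.prod_const_one, Finset.prod_const, Finset.card_univ,
    Fintype.card_fin] at hZ
  change ∫ y, pW β ε h lam y ^ (N₀ + n) = _ * morZ (N₀ + n) β ε h lam at hZ
  have hP := sum_formula (N₀ + n) hN β ε h lam hβ
    (Fin.addCases (fun i b => if b = ηbar i then 1 else 0) (fun _ _ => 1))
  have e1 : ∀ y, ∏ i, ∑ b, (Fin.addCases (motive := fun _ => Bool → ℝ)
      (fun i b => if b = ηbar i then 1 else 0) (fun (_ : Fin n) _ => 1) i : Bool → ℝ) b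
        * pA β ε h lam y b = (∏ i, pA β ε h lam y (ηbar i)) * pW β ε h lam y ^ n := by
    intro y
    rw [Fin.prod_univ_add]
    simp only [Fin.addCases_left, Fin.addCases_right, one_mul, ite_mul, zero_mul,
      Finset.sum_ite_eq', Finset.mem_univ, if_true, Finset.prod_const, Finset.card_univ,
      Fintype.card_fin]
    rfl
  simp only [e1] at hP
  rw [hP, hZ, mul_div_mul_left _ _ hC, etaCylProb, Finset.sum_div]
  refine Finset.sum_congr rfl fun σ _ => ?_
  rw [Finset.sum_div]
  refine Finset.sum_congr rfl fun η _ => ?_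
  rw [Fin.prod_univ_add]
  simp only [Fin.addCases_left, Fin.addCases_right, Finset.prod_const_one, mul_one]
  rw [morK]
  split_ifs with hc
  · rw [Finset.prod_eq_one, one_mul]
    intro i _
    rw [if_pos]
    exact hc i (by omega)
  · push Not at hc
    obtain ⟨i, hi, hne⟩ := hc
    rw [Finset.prod_eq_zero (Finset.mem_univ i), zero_mul, zero_div]
    rw [if_neg]
    exact hne

lemma laplace_sep (S : Set ℝ) (y0 : ℝ) (w : ℝ → ℝ) (hw : Continuous w)
    (hpos : ∀ y, 0 < w y) (hlim : Tendsto w (cocompact ℝ) (nhds 0))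
    (hmax : ∀ y ∈ closure S, y ≠ y0 → w y < w y0) (δ : ℝ) (hδ : 0 < δ) :
    ∃ ρ, 0 < ρ ∧ ρ < w y0 ∧ ∀ y ∈ S, δ ≤ dist y y0 → w y ≤ ρ := by
  have h0 := hpos y0
  have hev := hlim.eventually (gt_mem_nhds (half_pos h0))
  obtain ⟨t, ht, hts⟩ := mem_cocompact.1 hev
  set K : Set ℝ := t ∩ (closure S ∩ {y | δ ≤ dist y y0}) with hK
  have hKc : IsCompact K := ht.inter_right
    (isClosed_closure.inter (isClosed_le continuous_const (by fun_prop)))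
  have key : ∀ y ∈ S, δ ≤ dist y y0 → y ∈ K ∨ w y < w y0 / 2 := by
    intro y hy hd
    by_cases hyt : y ∈ t
    · exact Or.inl ⟨hyt, subset_closure hy, hd⟩
    · exact Or.inr (hts hyt)
  rcases K.eq_empty_or_nonempty with he | hne
  · refine ⟨w y0 / 2, by positivity, by linarith, fun y hy hd => ?_⟩
    rcases key y hy hd with h | h
    · rw [he] at h; exact h.elim
    · exact h.le
  · obtain ⟨z, hz, hzmax⟩ := hKc.exists_isMaxOn hne hw.continuousOn
    refine ⟨max (w z) (w y0 / 2), lt_max_of_lt_left (hpos z), max_lt ?_ (by linarith),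
      fun y hy hd => ?_⟩
    · refine hmax z hz.2.1 ?_
      rintro rfl
      have := hz.2.2
      simp only [Set.mem_ofPred_eq, dist_self] at this
      linarith
    · rcases key y hy hd with h | h
      · exact le_max_of_le_left (hzmax h)
      · exact le_max_of_le_right h.le

lemma laplace (S : Set ℝ) (hS : IsOpen S) (y0 : ℝ) (hy0 : y0 ∈ S) (w F : ℝ → ℝ)
    (hw : Continuous w) (hpos : ∀ y, 0 < w y) (hint : Integrable w)
    (hlim : Tendsto w (cocompact ℝ) (nhds 0))
    (hmax : ∀ y ∈ closure S, y ≠ y0 → w y < w y0)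
    (hF : Continuous F) (C : ℝ) (hC : ∀ y, |F y| ≤ C) :
    Tendsto (fun n : ℕ => (∫ y in S, F y * w y ^ (n + 1)) / ∫ y in S, w y ^ (n + 1))
      atTop (nhds (F y0)) := by
  have hle : ∀ y ∈ S, w y ≤ w y0 := by
    intro y hy
    by_cases h : y = y0
    · rw [h]
    · exact (hmax y (subset_closure hy) h).le
  have hSm := hS.measurableSet
  have hwi : ∀ n : ℕ, IntegrableOn (fun y => w y ^ (n + 1)) S := by
    intro n
    refine Integrable.mono' (hint.integrableOn.const_mul (w y0 ^ n)) (by fun_prop) ?_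
    refine (ae_restrict_iff' hSm).2 (Eventually.of_forall fun y hy => ?_)
    rw [Real.norm_of_nonneg (pow_nonneg (hpos y).le _), pow_succ]
    exact mul_le_mul_of_nonneg_right (pow_le_pow_left₀ (hpos y).le (hle y hy) n) (hpos y).le
  have hFi : ∀ n : ℕ, IntegrableOn (fun y => F y * w y ^ (n + 1)) S := by
    intro n
    refine Integrable.mono' ((hwi n).const_mul C) (by fun_prop) (Eventually.of_forall fun y => ?_)
    rw [norm_mul, Real.norm_of_nonneg (pow_nonneg (hpos y).le _)]
    exact mul_le_mul_of_nonneg_right (hC y) (pow_nonneg (hpos y).le _)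
  have hC0 : 0 ≤ C := (abs_nonneg _).trans (hC y0)
  rw [Metric.tendsto_atTop']
  intro e he
  obtain ⟨δ, hδ, hδF⟩ := Metric.continuous_iff.1 hF y0 (e / 2) (half_pos he)
  obtain ⟨ρ, hρ0, hρ, hρS⟩ := laplace_sep S y0 w hw hpos hlim hmax δ hδ
  obtain ⟨r, hr1, hr2⟩ := exists_between hρ
  have hr0 : 0 < r := hρ0.trans hr1
  set V : Set ℝ := S ∩ (w ⁻¹' Set.Ioi r ∩ Metric.ball y0 1) with hV
  have hVo : IsOpen V := hS.inter ((isOpen_Ioi.preimage hw).inter Metric.isOpen_ball)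
  have hVne : V.Nonempty := ⟨y0, hy0, hr2, Metric.mem_ball_self one_pos⟩
  have hVfin : volume V ≠ ⊤ :=
    ((measure_mono (fun y hy => hy.2.2)).trans_lt Metric.isBounded_ball.measure_lt_top).ne
  have hvpos : 0 < volume.real V :=
    ENNReal.toReal_pos (hVo.measure_pos volume hVne).ne' hVfin
  set v := volume.real V with hv
  have hD : ∀ n : ℕ, r ^ (n + 1) * v ≤ ∫ y in S, w y ^ (n + 1) := by
    intro n
    calc r ^ (n + 1) * v = ∫ y in V, r ^ (n + 1) := by
          rw [setIntegral_const, smul_eq_mul, mul_comm]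
      _ ≤ ∫ y in V, w y ^ (n + 1) := by
          refine setIntegral_mono_on (integrableOn_const hVfin)
            ((hwi n).mono_set Set.inter_subset_left) hVo.measurableSet fun y hy => ?_
          exact pow_le_pow_left₀ hr0.le (le_of_lt hy.2.1) _
      _ ≤ _ := setIntegral_mono_set (hwi n)
          (Eventually.of_forall fun y => pow_nonneg (hpos y).le _)
          (Set.inter_subset_left.eventuallyLE)
  set I := ∫ y in S, w y with hI
  have hmain : ∀ n : ℕ, |(∫ y in S, F y * w y ^ (n + 1)) - F y0 * ∫ y in S, w y ^ (n + 1)|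
      ≤ e / 2 * (∫ y in S, w y ^ (n + 1)) + 2 * C * ρ ^ n * I := by
    intro n
    rw [← integral_const_mul, ← integral_sub (hFi n) ((hwi n).const_mul _), hI,
      ← integral_const_mul, ← integral_const_mul, ← integral_add ((hwi n).const_mul _)
        (hint.integrableOn.const_mul _)]
    rw [← Real.norm_eq_abs]
    refine norm_integral_le_of_norm_le (((hwi n).const_mul _).add
        (hint.integrableOn.const_mul _)) ?_
    refine (ae_restrict_iff' hSm).2 (Eventually.of_forall fun y hy => ?_)
    have hwp : 0 ≤ w y ^ (n + 1) := pow_nonneg (hpos y).le _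
    rw [← sub_mul, norm_mul, Real.norm_of_nonneg hwp]
    by_cases hd : dist y y0 < δ
    · have h1 : ‖F y - F y0‖ ≤ e / 2 := by
        have := hδF y hd
        rw [dist_eq_norm] at this
        exact this.le
      have h2 : 0 ≤ 2 * C * ρ ^ n * w y :=
        mul_nonneg (by positivity) (hpos y).le
      have := mul_le_mul_of_nonneg_right h1 hwp
      linarith
    · have h1 : ‖F y - F y0‖ ≤ 2 * C := by
        have := norm_sub_le (F y) (F y0)
        have h3 := hC y
        have h4 := hC y0
        simp only [Real.norm_eq_abs] at *
        linarith
      have h2 : w y ^ (n + 1) ≤ ρ ^ n * w y := by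
        rw [pow_succ]
        exact mul_le_mul_of_nonneg_right
          (pow_le_pow_left₀ (hpos y).le (hρS y hy (not_lt.1 hd)) n) (hpos y).le
      have h3 : 0 ≤ e / 2 * w y ^ (n + 1) := by positivity
      have h4 := mul_le_mul h1 h2 hwp (by positivity)
      linarith
  have hI0 : 0 ≤ I := integral_nonneg fun y => (hpos y).le
  have hgeo : Tendsto (fun n : ℕ => (2 * C * I / (r * v)) * (ρ / r) ^ n) atTop (nhds 0) := by
    have := (tendsto_pow_atTop_nhds_zero_of_lt_one (div_nonneg hρ0.le hr0.le)
      ((div_lt_one hr0).2 hr1)).const_mul (2 * C * I / (r * v))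
    simpa using this
  obtain ⟨n0, hn0⟩ := (hgeo.eventually (gt_mem_nhds (half_pos he))).exists_forall_of_atTop
  refine ⟨n0, fun n hn => ?_⟩
  have hDn : 0 < ∫ y in S, w y ^ (n + 1) := lt_of_lt_of_le (by positivity) (hD n)
  rw [Real.dist_eq, div_sub' hDn.ne', abs_div, abs_of_pos hDn, div_lt_iff₀ hDn, mul_comm (∫ y in S, w y ^ (n + 1)) (F y0)]
  refine (hmain n).trans_lt ?_
  have h1 := hn0 n hn.le
  have h2 : 2 * C * ρ ^ n * I < e / 2 * (r ^ (n + 1) * v) := by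
    have : 2 * C * I / (r * v) * (ρ / r) ^ n = 2 * C * ρ ^ n * I / (r ^ (n + 1) * v) := by
      rw [div_pow, pow_succ]; field_simp
    rw [this, div_lt_iff₀ (by positivity)] at h1
    exact h1
  have h3 := mul_le_mul_of_nonneg_left (hD n) (half_pos he).le
  linarith

lemma tanh_strictMono' : StrictMono Real.tanh := by
  intro x y hxy
  rw [Real.tanh_eq_sinh_div_cosh, Real.tanh_eq_sinh_div_cosh,
    div_lt_div_iff₀ (Real.cosh_pos _) (Real.cosh_pos _)]
  have h : 0 < Real.sinh (y - x) := Real.sinh_pos_iff.2 (by linarith)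
  rw [Real.sinh_sub] at h
  linarith

lemma tanh_continuous' : Continuous Real.tanh := by
  have : Real.tanh = fun x => Real.sinh x / Real.cosh x := by
    funext x; exact Real.tanh_eq_sinh_div_cosh x
  rw [this]
  exact Real.continuous_sinh.div Real.continuous_cosh fun x => (Real.cosh_pos x).ne'

lemma tanh_pos' {x : ℝ} (hx : 0 < x) : 0 < Real.tanh x := by
  have := tanh_strictMono' hx
  rwa [Real.tanh_zero] at this

lemma sinh_star {x y : ℝ} (hx : 0 < x) (hxy : x < y) : y * Real.sinh x < x * Real.sinh y := by
  have hy : 0 < y := hx.trans hxy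
  have hconv : StrictConvexOn ℝ (Set.Ici 0) Real.sinh := by
    refine strictConvexOn_of_deriv2_pos (convex_Ici 0) Real.continuous_sinh.continuousOn ?_
    intro z hz
    rw [interior_Ici] at hz
    simpa [Real.sinh_pos_iff] using hz
  have h := hconv.2 (Set.mem_Ici.2 le_rfl) (Set.mem_Ici.2 hy.le) hy.ne
    (show (0 : ℝ) < 1 - x / y by rw [sub_pos, div_lt_one hy]; exact hxy)
    (show (0 : ℝ) < x / y by positivity) (by ring)
  simp only [smul_eq_mul, mul_zero, zero_add, Real.sinh_zero] at h
  rw [div_mul_cancel₀ _ hy.ne', div_mul_eq_mul_div, lt_div_iff₀ hy] at h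
  linarith

lemma tanh_star {s t : ℝ} (hs : 0 < s) (hst : s < t) : s * Real.tanh t < t * Real.tanh s := by
  rw [Real.tanh_eq_sinh_div_cosh, Real.tanh_eq_sinh_div_cosh, mul_div_assoc', mul_div_assoc',
    div_lt_div_iff₀ (Real.cosh_pos _) (Real.cosh_pos _)]
  have h := sinh_star (x := t - s) (y := t + s) (by linarith) (by linarith)
  rw [Real.sinh_add, Real.sinh_sub] at h
  nlinarith

def kf (β t : ℝ) : ℝ := t - β * Real.tanh t

lemma kf_continuous (β : ℝ) : Continuous (kf β) := by
  unfold kf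
  exact continuous_id.sub (continuous_const.mul tanh_continuous')

lemma kf_zero (β : ℝ) : kf β 0 = 0 := by simp [kf]

lemma kf_lt {β s t : ℝ} (hs : 0 < s) (hst : s < t) (hβ : 0 < β) (hk : 0 ≤ kf β s) :
    kf β s < kf β t := by
  unfold kf at *
  have h := tanh_star hs hst
  have h1 : s * (β * Real.tanh t) < t * (β * Real.tanh s) := by nlinarith
  have h2 : s * (s - β * Real.tanh s) < s * (t - β * Real.tanh t) := by nlinarith
  exact lt_of_mul_lt_mul_left h2 hs.le

lemma tanh_lt_self' {t : ℝ} (ht : 0 < t) : Real.tanh t < t := by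
  have h : Real.sinh t < t * Real.cosh t := by
    have := sinh_star (x := t) (y := 2 * t) ht (by linarith)
    rw [Real.sinh_two_mul] at this
    have hs : 0 < Real.sinh t := Real.sinh_pos_iff.2 ht
    have : 2 * t * Real.sinh t * 1 < 2 * t * Real.sinh t * Real.cosh t := by linarith
    have hc : 1 < Real.cosh t := lt_of_mul_lt_mul_left this (by positivity)
    have hmono : StrictMonoOn (fun x : ℝ => x * Real.cosh x - Real.sinh x) (Set.Ici 0) := by
      refine strictMonoOn_of_deriv_pos (convex_Ici 0) (by fun_prop) ?_
      intro z hz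
      rw [interior_Ici] at hz
      have hd : HasDerivAt (fun x : ℝ => x * Real.cosh x - Real.sinh x)
          (1 * Real.cosh z + z * Real.sinh z - Real.cosh z) z :=
        ((hasDerivAt_id z).mul (Real.hasDerivAt_cosh z)).sub (Real.hasDerivAt_sinh z)
      rw [hd.deriv]
      have := mul_pos hz (Real.sinh_pos_iff.2 hz)
      linarith
    have := hmono (Set.mem_Ici.2 le_rfl) (Set.mem_Ici.2 ht.le) ht
    simp at this
    linarith
  rw [Real.tanh_eq_sinh_div_cosh, div_lt_iff₀ (Real.cosh_pos _)]
  exact h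

lemma kf_pos_of_le {β t : ℝ} (hβ : 0 < β) (hβ1 : β ≤ 1) (ht : 0 < t) : 0 < kf β t := by
  unfold kf
  have := tanh_lt_self' ht
  have := tanh_pos' ht
  nlinarith

lemma kf_ge {β : ℝ} (hβ : 0 < β) (t : ℝ) : t - β ≤ kf β t := by
  unfold kf
  have := Real.tanh_lt_one t
  nlinarith

lemma exists_t0 {β θ : ℝ} (hβ : 0 < β) (hθ : 0 < θ) : ∃ t, 0 < t ∧ kf β t = θ := by
  have h := intermediate_value_Icc (a := 0) (b := θ + β) (by positivity)
    (kf_continuous β).continuousOn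
  have h2 := kf_ge hβ (θ + β)
  obtain ⟨t, ht, hk⟩ := h (show θ ∈ _ from ⟨by rw [kf_zero]; exact hθ.le, by linarith⟩)
  refine ⟨t, lt_of_le_of_ne ht.1 ?_, hk⟩
  rintro rfl
  rw [kf_zero] at hk
  linarith

lemma exists_tstar {β : ℝ} (hβ : 1 < β) : ∃ t, 0 < t ∧ kf β t = 0 := by
  have hβ0 : 0 < β := by linarith
  set s := √(Real.log β) with hs
  have hlog : 0 < Real.log β := Real.log_pos hβ
  have hs0 : 0 < s := Real.sqrt_pos.2 hlog
  have hc : Real.cosh s < β := by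
    refine (Real.cosh_le_exp_half_sq s).trans_lt ?_
    rw [hs, Real.sq_sqrt hlog.le]
    calc Real.exp (Real.log β / 2) < Real.exp (Real.log β) := Real.exp_lt_exp.2 (by linarith)
      _ = β := Real.exp_log hβ0
  have hk : kf β s < 0 := by
    unfold kf
    rw [Real.tanh_eq_sinh_div_cosh, sub_neg, mul_div_assoc', lt_div_iff₀ (Real.cosh_pos _)]
    have h1 : s < Real.sinh s := Real.self_lt_sinh_iff.2 hs0
    nlinarith
  have hk2 : 0 ≤ kf β (s + β) := by
    have := kf_ge hβ0 (s + β)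
    linarith
  obtain ⟨t, ht, hk⟩ := intermediate_value_Icc (a := s) (b := s + β) (by linarith)
    (kf_continuous β).continuousOn (show (0 : ℝ) ∈ _ from ⟨hk.le, hk2⟩)
  exact ⟨t, hs0.trans_le ht.1, hk⟩

def wf (β θ y : ℝ) : ℝ := Real.exp (-β * y ^ 2 / 2) * Real.cosh (β * y + θ)

def ff (β θ y : ℝ) : ℝ := -β * y ^ 2 / 2 + Real.log (Real.cosh (β * y + θ))

lemma wf_eq (β θ y : ℝ) : wf β θ y = Real.exp (ff β θ y) := by
  rw [wf, ff, Real.exp_add, Real.exp_log (Real.cosh_pos _)]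

lemma ff_deriv (β θ y : ℝ) : HasDerivAt (ff β θ) (θ - kf β (β * y + θ)) y := by
  have h1 : HasDerivAt (fun y : ℝ => β * y + θ) β y := by
    simpa using ((hasDerivAt_id y).const_mul β).add_const θ
  have h2 := (h1.cosh).log (Real.cosh_pos _).ne'
  have h3 : HasDerivAt (fun y : ℝ => -β * y ^ 2 / 2) (-β * y) y := by
    have := ((hasDerivAt_pow 2 y).const_mul (-β)).div_const 2
    refine this.congr_deriv ?_
    norm_num
    ring
  have h4 := h3.add h2
  unfold kf
  rw [Real.tanh_eq_sinh_div_cosh]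
  refine h4.congr_deriv ?_
  ring

/-- the maximum property on the half line -/
lemma wf_lt_half {β θ t0 : ℝ} (hβ : 0 < β) (hθ : 0 ≤ θ) (hk : kf β t0 = θ)
    (h1 : ∀ t, t0 < t → θ < kf β t) (h2 : ∀ t, 0 < t → t < t0 → kf β t < θ)
    {y : ℝ} (hy : 0 ≤ y) (hne : y ≠ Real.tanh t0) : wf β θ y < wf β θ (Real.tanh t0) := by
  have ht0 : β * Real.tanh t0 + θ = t0 := by unfold kf at hk; linarith
  rw [wf_eq, wf_eq, Real.exp_lt_exp]
  have hc : Continuous (ff β θ) :=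
    continuous_iff_continuousAt.2 fun y => (ff_deriv β θ y).continuousAt
  rcases lt_or_gt_of_ne hne with h | h
  · have : StrictMonoOn (ff β θ) (Set.Icc 0 (Real.tanh t0)) := by
      refine strictMonoOn_of_deriv_pos (convex_Icc _ _) hc.continuousOn ?_
      intro z hz
      rw [interior_Icc] at hz
      rw [(ff_deriv β θ z).deriv, sub_pos]
      have a1 := mul_lt_mul_of_pos_left hz.2 hβ
      have a2 := mul_pos hβ hz.1
      exact h2 _ (by linarith) (by linarith)
    exact this ⟨hy, h.le⟩ ⟨hy.trans h.le, le_rfl⟩ h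
  · have : StrictAntiOn (ff β θ) (Set.Ici (Real.tanh t0)) := by
      refine strictAntiOn_of_deriv_neg (convex_Ici _) hc.continuousOn ?_
      intro z hz
      rw [interior_Ici] at hz
      rw [(ff_deriv β θ z).deriv, sub_neg]
      have a1 := mul_lt_mul_of_pos_left hz hβ
      exact h1 _ (by linarith)
    exact this (Set.mem_Ici.2 le_rfl) (Set.mem_Ici.2 h.le) h

lemma wf_lt_univ {β θ t0 : ℝ} (hβ : 0 < β) (hθ : 0 ≤ θ) (hk : kf β t0 = θ)
    (h1 : ∀ t, t0 < t → θ < kf β t) (h2 : ∀ t, 0 < t → t < t0 → kf β t < θ)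
    (h3 : 0 < θ ∨ t0 = 0)
    {y : ℝ} (hne : y ≠ Real.tanh t0) : wf β θ y < wf β θ (Real.tanh t0) := by
  rcases le_or_gt 0 y with hy | hy
  · exact wf_lt_half hβ hθ hk h1 h2 hy hne
  · have hby : β * y < 0 := mul_neg_of_pos_of_neg hβ hy
    by_cases hy2 : -y = Real.tanh t0
    · have hθ' : 0 < θ := by
        rcases h3 with h3 | h3
        · exact h3
        · rw [h3, Real.tanh_zero] at hy2; linarith
      rw [← hy2]
      unfold wf
      rw [neg_sq]
      refine mul_lt_mul_of_pos_left ?_ (Real.exp_pos _)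
      rw [Real.cosh_lt_cosh, abs_lt]
      rw [abs_of_pos (by linarith)]
      constructor <;> linarith
    · refine lt_of_le_of_lt ?_ (wf_lt_half hβ hθ hk h1 h2 (by linarith : 0 ≤ -y) hy2)
      unfold wf
      rw [neg_sq]
      refine mul_le_mul_of_nonneg_left ?_ (Real.exp_pos _).le
      rw [Real.cosh_le_cosh, abs_le]
      rw [abs_of_pos (by linarith)]
      constructor <;> linarith

lemma wf_pos (β θ y : ℝ) : 0 < wf β θ y := mul_pos (Real.exp_pos _) (Real.cosh_pos _)

lemma wf_continuous (β θ : ℝ) : Continuous (wf β θ) := by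
  unfold wf
  fun_prop

lemma wf_integrable {β : ℝ} (θ : ℝ) (hβ : 0 < β) : Integrable (wf β θ) := by
  have h1 := (hs_integrable 1 1 β one_pos hβ).mul_const (Real.exp θ / 2)
  have h2 := (hs_integrable 1 (-1) β one_pos hβ).mul_const (Real.exp (-θ) / 2)
  refine (h1.add h2).congr (Eventually.of_forall fun y => ?_)
  simp only [Pi.add_apply, wf, Real.cosh_eq, mul_div_assoc', ← Real.exp_add, ← add_div, mul_add]
  congr 3 <;> ring

lemma wf_lim {β : ℝ} (θ : ℝ) (hβ : 0 < β) : Tendsto (wf β θ) (cocompact ℝ) (nhds 0) := by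
  have hb : ∀ y, wf β θ y ≤ Real.exp (2 * β + |θ|) * Real.exp (-(β * ‖y‖)) := by
    intro y
    have hcosh : Real.cosh (β * y + θ) ≤ Real.exp (β * |y| + |θ|) := by
      have habs : |β * y + θ| ≤ β * |y| + |θ| := by
        refine (abs_add_le _ _).trans ?_
        rw [abs_mul, abs_of_pos hβ]
      rw [← Real.cosh_abs, Real.cosh_eq]
      have i1 := Real.exp_le_exp.2 habs
      have i2 : Real.exp (-|β * y + θ|) ≤ Real.exp (β * |y| + |θ|) :=
        Real.exp_le_exp.2 (by have := abs_nonneg (β * y + θ); linarith)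
      linarith
    unfold wf
    refine (mul_le_mul_of_nonneg_left hcosh (Real.exp_pos _).le).trans ?_
    rw [← Real.exp_add, ← Real.exp_add, Real.exp_le_exp, Real.norm_eq_abs, ← sq_abs y]
    nlinarith [mul_nonneg hβ.le (sq_nonneg (|y| - 2))]
  have hg : Tendsto (fun y : ℝ => Real.exp (2 * β + |θ|) * Real.exp (-(β * ‖y‖)))
      (cocompact ℝ) (nhds 0) := by
    have := (Real.tendsto_exp_neg_atTop_nhds_zero.comp
      ((tendsto_norm_cocompact_atTop (E := ℝ)).const_mul_atTop hβ)).const_mul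
        (Real.exp (2 * β + |θ|))
    simpa [Function.comp_def] using this
  exact squeeze_zero (fun y => (wf_pos β θ y).le) hb hg

def th (β ε h lam : ℝ) : ℝ :=
  β * h + (Real.log (Real.cosh (lam + β * ε)) - Real.log (Real.cosh (lam - β * ε))) / 2

def gg (β ε lam : ℝ) : ℝ :=
  Real.exp ((Real.log (Real.cosh (lam + β * ε)) + Real.log (Real.cosh (lam - β * ε))) / 2)

def EE (β ε h lam y : ℝ) : ℝ :=
  (Real.sinh (2 * lam) + Real.tanh (β * y + th β ε h lam) * Real.sinh (2 * (β * ε))) /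
    (2 * (Real.cosh (lam + β * ε) * Real.cosh (lam - β * ε)))

lemma pA_form (β ε h lam y : ℝ) (b : Bool) :
    pA β ε h lam y b = Real.exp (-β * y ^ 2 / 2) *
      (Real.exp (β * y + β * h) * (Real.cosh (lam + β * ε) + spin b * Real.sinh (lam + β * ε)) +
       Real.exp (-(β * y + β * h)) *
        (Real.cosh (lam - β * ε) + spin b * Real.sinh (lam - β * ε))) := by
  cases b
  · simp only [pA, pE, spin, Fintype.sum_bool, if_true, Bool.false_eq_true, if_false, neg_one_mul,
      ← sub_eq_add_neg, Real.cosh_sub_sinh]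
    simp only [mul_add, ← Real.exp_add]
    congr 2 <;> ring
  · simp only [pA, pE, spin, Fintype.sum_bool, if_true, Bool.false_eq_true, if_false, one_mul,
      Real.cosh_add_sinh]
    simp only [mul_add, ← Real.exp_add]
    congr 2 <;> ring

lemma exp_th_pos (β ε h lam y : ℝ) :
    Real.exp (β * y + th β ε h lam) * gg β ε lam
      = Real.exp (β * y + β * h) * Real.cosh (lam + β * ε) := by
  conv_rhs => rw [← Real.exp_log (Real.cosh_pos (lam + β * ε))]
  rw [gg, th, ← Real.exp_add, ← Real.exp_add]
  congr 1
  ring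

lemma exp_th_neg (β ε h lam y : ℝ) :
    Real.exp (-(β * y + th β ε h lam)) * gg β ε lam
      = Real.exp (-(β * y + β * h)) * Real.cosh (lam - β * ε) := by
  conv_rhs => rw [← Real.exp_log (Real.cosh_pos (lam - β * ε))]
  rw [gg, th, ← Real.exp_add, ← Real.exp_add]
  congr 1
  ring

lemma pW_form (β ε h lam y : ℝ) : pW β ε h lam y = 2 * (Real.exp (-β * y ^ 2 / 2) *
      (Real.exp (β * y + β * h) * Real.cosh (lam + β * ε) +
       Real.exp (-(β * y + β * h)) * Real.cosh (lam - β * ε))) := by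
  rw [pW, Fintype.sum_bool, pA_form, pA_form]
  simp only [spin, if_true, Bool.false_eq_true, if_false]
  ring

lemma pW_eq (β ε h lam y : ℝ) :
    pW β ε h lam y = 4 * gg β ε lam * wf β (th β ε h lam) y := by
  rw [pW_form, ← exp_th_pos, ← exp_th_neg, wf, Real.cosh_eq]
  ring

lemma tanh_th (β ε h lam y : ℝ) :
    Real.tanh (β * y + th β ε h lam) *
      (Real.exp (β * y + β * h) * Real.cosh (lam + β * ε) +
       Real.exp (-(β * y + β * h)) * Real.cosh (lam - β * ε))
      = Real.exp (β * y + β * h) * Real.cosh (lam + β * ε) -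
       Real.exp (-(β * y + β * h)) * Real.cosh (lam - β * ε) := by
  rw [← exp_th_pos, ← exp_th_neg, Real.tanh_eq]
  have := Real.exp_pos (β * y + th β ε h lam)
  have := Real.exp_pos (-(β * y + th β ε h lam))
  field_simp

lemma pA_eq (β ε h lam y : ℝ) (b : Bool) :
    pA β ε h lam y b = (1 + spin b * EE β ε h lam y) / 2 * pW β ε h lam y := by
  rw [pA_form, pW_form, EE]
  have ht := tanh_th β ε h lam y
  set T := Real.tanh (β * y + th β ε h lam)
  set u := Real.exp (β * y + β * h)
  set v := Real.exp (-(β * y + β * h))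
  have e1 : Real.sinh (2 * lam) = Real.sinh (lam + β * ε) * Real.cosh (lam - β * ε) +
      Real.cosh (lam + β * ε) * Real.sinh (lam - β * ε) := by
    rw [← Real.sinh_add]; congr 1; ring
  have e2 : Real.sinh (2 * (β * ε)) = Real.sinh (lam + β * ε) * Real.cosh (lam - β * ε) -
      Real.cosh (lam + β * ε) * Real.sinh (lam - β * ε) := by
    rw [← Real.sinh_sub]; congr 1; ring
  rw [e1, e2]
  have hP := (Real.cosh_pos (lam + β * ε)).ne'
  have hQ := (Real.cosh_pos (lam - β * ε)).ne'
  set P := Real.cosh (lam + β * ε)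
  set Q := Real.cosh (lam - β * ε)
  set A := Real.sinh (lam + β * ε)
  set B := Real.sinh (lam - β * ε)
  have key : u * A + v * B
      = (A * Q + P * B + T * (A * Q - P * B)) / (2 * (P * Q)) * (u * P + v * Q) := by
    rw [div_mul_eq_mul_div, eq_div_iff (by positivity)]
    linear_combination -(A * Q - P * B) * ht
  linear_combination Real.exp (-β * y ^ 2 / 2) * spin b * key

lemma gg_pos (β ε lam : ℝ) : 0 < gg β ε lam := Real.exp_pos _

lemma pW_pos (β ε h lam y : ℝ) : 0 < pW β ε h lam y := by
  rw [pW_eq]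
  have := gg_pos β ε lam
  have := wf_pos β (th β ε h lam) y
  positivity

lemma pA_pos (β ε h lam y : ℝ) (b : Bool) : 0 < pA β ε h lam y b := by
  unfold pA pE
  rw [Fintype.sum_bool]
  positivity

def FF (β ε h lam : ℝ) {N₀ : ℕ} (ηbar : Fin N₀ → Bool) (y : ℝ) : ℝ :=
  ∏ i, (1 + spin (ηbar i) * EE β ε h lam y) / 2

lemma fac_bound (β ε h lam y : ℝ) (b : Bool) :
    |(1 + spin b * EE β ε h lam y) / 2| ≤ 1 := by
  have hW := pW_pos β ε h lam y
  have h1 := pA_eq β ε h lam y b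
  have h2 : (1 + spin b * EE β ε h lam y) / 2 = pA β ε h lam y b / pW β ε h lam y := by
    rw [h1, mul_div_cancel_right₀ _ hW.ne']
  have h3 : pA β ε h lam y b ≤ pW β ε h lam y := by
    unfold pW
    exact Finset.single_le_sum (fun b _ => (pA_pos β ε h lam y b).le) (Finset.mem_univ b)
  rw [h2, abs_of_pos (div_pos (pA_pos _ _ _ _ _ _) hW), div_le_one hW]
  exact h3

lemma FF_bound (β ε h lam y : ℝ) {N₀ : ℕ} (ηbar : Fin N₀ → Bool) :
    |FF β ε h lam ηbar y| ≤ 1 := by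
  unfold FF
  rw [Finset.abs_prod]
  exact Finset.prod_le_one (fun _ _ => abs_nonneg _) fun i _ => fac_bound β ε h lam y _

lemma EE_continuous (β ε h lam : ℝ) : Continuous (EE β ε h lam) := by
  unfold EE
  refine Continuous.div_const ?_ _
  exact continuous_const.add ((tanh_continuous'.comp (by fun_prop)).mul continuous_const)

lemma FF_continuous (β ε h lam : ℝ) {N₀ : ℕ} (ηbar : Fin N₀ → Bool) :
    Continuous (FF β ε h lam ηbar) := by
  unfold FF
  have := EE_continuous β ε h lam
  fun_prop

lemma pW_continuous (β ε h lam : ℝ) : Continuous (pW β ε h lam) := by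
  have : pW β ε h lam = fun y => 4 * gg β ε lam * wf β (th β ε h lam) y :=
    funext fun y => pW_eq β ε h lam y
  rw [this]
  exact continuous_const.mul (wf_continuous _ _)

lemma pW_integrable {β : ℝ} (ε h lam : ℝ) (hβ : 0 < β) : Integrable (pW β ε h lam) := by
  have : pW β ε h lam = fun y => 4 * gg β ε lam * wf β (th β ε h lam) y :=
    funext fun y => pW_eq β ε h lam y
  rw [this]
  exact (wf_integrable _ hβ).const_mul _

lemma pW_lim {β : ℝ} (ε h lam : ℝ) (hβ : 0 < β) :
    Tendsto (pW β ε h lam) (cocompact ℝ) (nhds 0) := by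
  have : pW β ε h lam = fun y => 4 * gg β ε lam * wf β (th β ε h lam) y :=
    funext fun y => pW_eq β ε h lam y
  rw [this]
  simpa using (wf_lim (th β ε h lam) hβ).const_mul (4 * gg β ε lam)

lemma pW_lt {β ε h lam y z : ℝ} (hlt : wf β (th β ε h lam) y < wf β (th β ε h lam) z) :
    pW β ε h lam y < pW β ε h lam z := by
  rw [pW_eq, pW_eq]
  exact mul_lt_mul_of_pos_left hlt (by have := gg_pos β ε lam; positivity)

lemma cyl_tendsto {β ε h lam : ℝ} (hβ : 0 < β) {N₀ : ℕ} (ηbar : Fin N₀ → Bool) (L : ℝ)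
    (hL : Tendsto (fun n : ℕ => (∫ y, FF β ε h lam ηbar y * pW β ε h lam y ^ (n + 1)) /
      ∫ y, pW β ε h lam y ^ (n + 1)) atTop (nhds L)) :
    Tendsto (fun N => etaCylProb N₀ N β ε h lam ηbar) atTop (nhds L) := by
  rw [← tendsto_add_atTop_iff_nat (N₀ + 1)]
  have h1 := hL.comp (tendsto_add_atTop_nat N₀)
  refine h1.congr fun m => ?_
  simp only [Function.comp]
  rw [show m + (N₀ + 1) = N₀ + (m + 1) by ring, cyl_formula N₀ (m + 1) (by omega) β ε h lam hβ,
    show m + N₀ + 1 = N₀ + (m + 1) by ring]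
  congr 2
  funext y
  simp only [FF, pA_eq, Finset.prod_mul_distrib, Finset.prod_const, Finset.card_univ,
    Fintype.card_fin]
  ring

lemma cyl_lim_unique {β ε h lam t0 : ℝ} (hβ : 0 < β) (hθ : 0 ≤ th β ε h lam)
    (hk : kf β t0 = th β ε h lam)
    (h1 : ∀ t, t0 < t → th β ε h lam < kf β t)
    (h2 : ∀ t, 0 < t → t < t0 → kf β t < th β ε h lam)
    (h3 : 0 < th β ε h lam ∨ t0 = 0) {N₀ : ℕ} (ηbar : Fin N₀ → Bool) :
    Tendsto (fun N => etaCylProb N₀ N β ε h lam ηbar) atTop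
      (nhds (FF β ε h lam ηbar (Real.tanh t0))) := by
  apply cyl_tendsto hβ
  have := laplace Set.univ isOpen_univ (Real.tanh t0) (Set.mem_univ _) (pW β ε h lam)
    (FF β ε h lam ηbar) (pW_continuous β ε h lam) (pW_pos β ε h lam) (pW_integrable ε h lam hβ)
    (pW_lim ε h lam hβ) (fun y _ hne => pW_lt (wf_lt_univ hβ hθ hk h1 h2 h3 hne))
    (FF_continuous β ε h lam ηbar) 1 (fun y => FF_bound β ε h lam y ηbar)
  simpa only [setIntegral_univ] using this

lemma cyl_lim_sym {β ε h lam t0 : ℝ} (hβ : 0 < β) (hθ : th β ε h lam = 0)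
    (ht0 : 0 < t0) (hk : kf β t0 = 0)
    (h1 : ∀ t, t0 < t → 0 < kf β t)
    (h2 : ∀ t, 0 < t → t < t0 → kf β t < 0)
    {N₀ : ℕ} (ηbar : Fin N₀ → Bool) :
    Tendsto (fun N => etaCylProb N₀ N β ε h lam ηbar) atTop
      (nhds ((FF β ε h lam ηbar (Real.tanh t0) + FF β ε h lam ηbar (-Real.tanh t0)) / 2)) := by
  apply cyl_tendsto hβ
  set W := pW β ε h lam with hW
  set F := FF β ε h lam ηbar with hF
  have hWeven : ∀ y, W (-y) = W y := by
    intro y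
    rw [hW, pW_eq, pW_eq, hθ]
    unfold wf
    rw [neg_sq, mul_neg, ← Real.cosh_neg (β * y + 0)]
    congr 3
    ring
  have hWabs : ∀ y, W |y| = W y := by
    intro y
    rcases abs_choice y with h | h <;> rw [h]
    exact hWeven y
  set Fs : ℝ → ℝ := fun y => (F y + F (-y)) / 2 with hFs
  have hFsabs : ∀ y, Fs |y| = Fs y := by
    intro y
    rcases abs_choice y with h | h <;> rw [h]
    simp only [hFs, neg_neg, add_comm]
  have hFc : Continuous F := FF_continuous β ε h lam ηbar
  have hWc : Continuous W := pW_continuous β ε h lam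
  have hmax : ∀ y ∈ closure (Set.Ioi (0 : ℝ)), y ≠ Real.tanh t0 → W y < W (Real.tanh t0) := by
    intro y hy hne
    rw [closure_Ioi] at hy
    refine pW_lt ?_
    rw [hθ]
    exact wf_lt_half hβ le_rfl hk h1 h2 hy hne
  have hlap := laplace (Set.Ioi 0) isOpen_Ioi (Real.tanh t0) (tanh_pos' ht0) W
    Fs hWc (pW_pos β ε h lam) (pW_integrable ε h lam hβ)
    (pW_lim ε h lam hβ) hmax (by fun_prop) 1 (fun y => by
      have a1 := FF_bound β ε h lam y ηbar
      have a2 := FF_bound β ε h lam (-y) ηbar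
      rw [← hF, abs_le] at a1 a2
      rw [abs_le]
      simp only [hFs]
      constructor <;> linarith)
  refine hlap.congr fun n => ?_
  have hint : ∀ n : ℕ, Integrable (fun y => W y ^ (n + 1)) := by
    intro n
    obtain ⟨M, hM⟩ : ∃ M, ∀ y, W y ≤ M := by
      refine ⟨W (Real.tanh t0), fun y => ?_⟩
      rw [← hWabs y]
      by_cases hy : |y| = Real.tanh t0
      · rw [hy]
      · refine (hmax _ ?_ hy).le
        rw [closure_Ioi]
        exact abs_nonneg y
    refine Integrable.mono' ((pW_integrable ε h lam hβ).const_mul (M ^ n)) (by fun_prop)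
      (Eventually.of_forall fun y => ?_)
    have hp : 0 < W y := pW_pos β ε h lam y
    rw [Real.norm_of_nonneg (pow_nonneg hp.le _), pow_succ]
    exact mul_le_mul_of_nonneg_right (pow_le_pow_left₀ hp.le (hM y) n) hp.le
  have hFi : Integrable (fun y => F y * W y ^ (n + 1)) := by
    refine Integrable.mono' (hint n) (by fun_prop) (Eventually.of_forall fun y => ?_)
    have hp : 0 < W y := pW_pos β ε h lam y
    rw [norm_mul, Real.norm_of_nonneg (pow_nonneg hp.le _)]
    exact mul_le_of_le_one_left (pow_nonneg hp.le _) (FF_bound β ε h lam y ηbar)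
  have hFi' : Integrable (fun y => F (-y) * W y ^ (n + 1)) := by
    have := hFi.comp_neg
    simpa only [hWeven] using this
  have e1 : ∫ y, F y * W y ^ (n + 1) = ∫ y, Fs y * W y ^ (n + 1) := by
    have a1 : ∫ y, F (-y) * W y ^ (n + 1) = ∫ y, F y * W y ^ (n + 1) := by
      have := integral_neg_eq_self (fun y => F y * W y ^ (n + 1)) volume
      simpa only [hWeven] using this
    have a2 : ∀ y, Fs y * W y ^ (n + 1)
        = (F y * W y ^ (n + 1) + F (-y) * W y ^ (n + 1)) / 2 := by
      intro y; simp only [hFs]; ring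
    simp only [a2]
    rw [integral_div, integral_add hFi hFi', a1]
    ring
  have e2 : ∫ y, Fs y * W y ^ (n + 1) = 2 * ∫ y in Set.Ioi 0, Fs y * W y ^ (n + 1) := by
    rw [← integral_comp_abs (f := fun y => Fs y * W y ^ (n + 1))]
    simp only [hWabs, hFsabs]
  have e3 : ∫ y, W y ^ (n + 1) = 2 * ∫ y in Set.Ioi 0, W y ^ (n + 1) := by
    rw [← integral_comp_abs (f := fun y => W y ^ (n + 1))]
    simp only [hWabs]
  rw [e1, e2, e3, mul_div_mul_left _ _ two_ne_zero]

lemma spin_not (b : Bool) : spin (!b) = -spin b := by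
  cases b <;> simp [spin]

lemma morH_neg (N : ℕ) (β ε h lam : ℝ) (σ η : Fin N → Bool) :
    morH N β ε (-h) (-lam) (fun i => !σ i) (fun i => !η i) = morH N β ε h lam σ η := by
  unfold morH
  simp only [spin_not, Finset.sum_neg_distrib, neg_sq]
  have : ∀ i, (ε * -spin (η i) + -h) * -spin (σ i) = (ε * spin (η i) + h) * spin (σ i) :=
    fun i => by ring
  simp only [this]
  ring

lemma sum_flip (N : ℕ) (f : (Fin N → Bool) → ℝ) :
    ∑ σ : Fin N → Bool, f (fun i => !σ i) = ∑ σ, f σ :=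
  Fintype.sum_equiv (Equiv.piCongrRight fun _ => Equiv.boolNot) _ _ fun _ => rfl

lemma cyl_neg (N₀ N : ℕ) (β ε h lam : ℝ) (ηbar : Fin N₀ → Bool) :
    etaCylProb N₀ N β ε (-h) (-lam) ηbar = etaCylProb N₀ N β ε h lam (fun i => !ηbar i) := by
  have hZ : morZ N β ε (-h) (-lam) = morZ N β ε h lam := by
    unfold morZ
    rw [← sum_flip]
    refine Finset.sum_congr rfl fun σ _ => ?_
    rw [← sum_flip]
    refine Finset.sum_congr rfl fun η _ => ?_
    rw [morH_neg]
  unfold etaCylProb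
  rw [← sum_flip]
  refine Finset.sum_congr rfl fun σ _ => ?_
  rw [← sum_flip]
  refine Finset.sum_congr rfl fun η _ => ?_
  unfold morK
  rw [morH_neg, hZ]
  refine if_congr ?_ rfl rfl
  refine forall_congr' fun i => forall_congr' fun hi => ?_
  beta_reduce
  generalize η ⟨i, hi⟩ = x
  generalize ηbar i = y
  cases x <;> cases y <;> simp

lemma neutral_of_neg {β ε h lam : ℝ} (hn : IsNeutral β ε h lam) :
    IsNeutral β ε (-h) (-lam) := by
  intro N₀ ηbar
  simp only [cyl_neg]
  exact hn N₀ _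

lemma neutral_neg_iff {β ε h lam : ℝ} :
    IsNeutral β ε (-h) (-lam) ↔ IsNeutral β ε h lam := by
  refine ⟨fun hn => ?_, neutral_of_neg⟩
  have := neutral_of_neg hn
  rwa [neg_neg, neg_neg] at this

lemma FF_zero {β ε h lam y : ℝ} (hE : EE β ε h lam y = 0) {N₀ : ℕ} (ηbar : Fin N₀ → Bool) :
    FF β ε h lam ηbar y = (2 : ℝ)⁻¹ ^ N₀ := by
  simp [FF, hE]

lemma neutral_unique {β ε h lam t0 : ℝ} (hβ : 0 < β) (hθ : 0 ≤ th β ε h lam)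
    (hk : kf β t0 = th β ε h lam)
    (h1 : ∀ t, t0 < t → th β ε h lam < kf β t)
    (h2 : ∀ t, 0 < t → t < t0 → kf β t < th β ε h lam)
    (h3 : 0 < th β ε h lam ∨ t0 = 0) :
    IsNeutral β ε h lam ↔
      Real.sinh (2 * lam) = - (Real.tanh t0 * Real.sinh (2 * (β * ε))) := by
  have hE : EE β ε h lam (Real.tanh t0) = 0 ↔
      Real.sinh (2 * lam) = - (Real.tanh t0 * Real.sinh (2 * (β * ε))) := by
    have ht0 : β * Real.tanh t0 + th β ε h lam = t0 := by unfold kf at hk; linarith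
    have hP := Real.cosh_pos (lam + β * ε)
    have hQ := Real.cosh_pos (lam - β * ε)
    rw [EE, ht0, div_eq_zero_iff, or_iff_left (by positivity)]
    constructor <;> intro h <;> linarith
  rw [← hE]
  constructor
  · intro hn
    have := tendsto_nhds_unique (hn 1 (fun _ => true))
      (cyl_lim_unique hβ hθ hk h1 h2 h3 (fun _ : Fin 1 => true))
    simp [FF, spin] at this
    linarith
  · intro h0 N₀ ηbar
    have := cyl_lim_unique hβ hθ hk h1 h2 h3 ηbar
    rwa [FF_zero h0] at this

lemma not_neutral_sym {β ε h lam t0 : ℝ} (hβ : 0 < β) (hε : 0 < ε) (hθ : th β ε h lam = 0)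
    (ht0 : 0 < t0) (hk : kf β t0 = 0)
    (h1 : ∀ t, t0 < t → 0 < kf β t)
    (h2 : ∀ t, 0 < t → t < t0 → kf β t < 0) : ¬ IsNeutral β ε h lam := by
  intro hn
  have l1 := tendsto_nhds_unique (hn 1 (fun _ => true))
      (cyl_lim_sym hβ hθ ht0 hk h1 h2 (fun _ : Fin 1 => true))
  have l2 := tendsto_nhds_unique (hn 2 (fun _ => true))
      (cyl_lim_sym hβ hθ ht0 hk h1 h2 (fun _ : Fin 2 => true))
  simp only [FF, spin, Finset.prod_const, Finset.card_univ, Fintype.card_fin, if_true] at l1 l2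
  have ht : β * Real.tanh t0 = t0 := by unfold kf at hk; linarith
  have hP := Real.cosh_pos (lam + β * ε)
  have hQ := Real.cosh_pos (lam - β * ε)
  set u := EE β ε h lam (Real.tanh t0) with hu
  set v := EE β ε h lam (-Real.tanh t0) with hv
  have huv : u ^ 2 + v ^ 2 = 0 := by nlinarith
  have hu0 : u = 0 := by nlinarith [sq_nonneg u, sq_nonneg v]
  have hv0 : v = 0 := by nlinarith [sq_nonneg u, sq_nonneg v]
  rw [hu, EE, hθ, ht, div_eq_zero_iff, or_iff_left (by positivity), add_zero] at hu0
  rw [hv, EE, hθ, mul_neg, ht, div_eq_zero_iff, or_iff_left (by positivity), add_zero,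
    Real.tanh_neg] at hv0
  have hs : 0 < Real.sinh (2 * (β * ε)) := Real.sinh_pos_iff.2 (by positivity)
  have := mul_pos (tanh_pos' ht0) hs
  linarith

lemma exists_ts {β : ℝ} (hβ : 0 < β) : ∃ ts : ℝ, 0 ≤ ts ∧ kf β ts = 0 ∧ (β ≤ 1 → ts = 0) ∧
    (1 < β → 0 < ts) ∧ (∀ t, ts < t → 0 < kf β t) ∧ (∀ t, 0 < t → t < ts → kf β t < 0) := by
  rcases le_or_gt β 1 with h | h
  · exact ⟨0, le_rfl, kf_zero β, fun _ => rfl, fun h' => by linarith,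
      fun t ht => kf_pos_of_le hβ h ht, fun t h1 h2 => by linarith⟩
  · obtain ⟨t, ht, hk⟩ := exists_tstar h
    refine ⟨t, ht.le, hk, fun h' => by linarith, fun _ => ht, fun s hs => ?_, fun s h1 h2 => ?_⟩
    · have := kf_lt ht hs hβ hk.ge
      linarith
    · by_contra hc
      have := kf_lt h1 h2 hβ (not_lt.1 hc)
      linarith

def Rr (c x : ℝ) : ℝ := (Real.log (Real.cosh (x + c)) - Real.log (Real.cosh (x - c))) / 2

lemma Rr_neg (c x : ℝ) : Rr c (-x) = -Rr c x := by
  unfold Rr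
  rw [← Real.cosh_neg (-x + c), ← Real.cosh_neg (-x - c), show -(-x + c) = x - c by ring,
    show -(-x - c) = x + c by ring]
  ring

lemma Rr_zero (c : ℝ) : Rr c 0 = 0 := by
  have := Rr_neg c 0
  rw [neg_zero] at this
  linarith

lemma Rr_strictMono {c : ℝ} (hc : 0 < c) : StrictMono (Rr c) := by
  intro x y hxy
  unfold Rr
  have hpos := Real.cosh_pos
  have : Real.log (Real.cosh (x + c) * Real.cosh (y - c))
      < Real.log (Real.cosh (y + c) * Real.cosh (x - c)) := by
    refine Real.log_lt_log (mul_pos (hpos _) (hpos _)) ?_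
    have h1 : Real.cosh (y + c) * Real.cosh (x - c) - Real.cosh (x + c) * Real.cosh (y - c)
        = 2 * Real.sinh c * Real.cosh c * Real.sinh (y - x) := by
      rw [Real.cosh_add, Real.cosh_add, Real.cosh_sub, Real.cosh_sub, Real.sinh_sub]
      ring
    have h2 : 0 < 2 * Real.sinh c * Real.cosh c * Real.sinh (y - x) := by
      have a1 := Real.sinh_pos_iff.2 hc
      have a2 := Real.sinh_pos_iff.2 (sub_pos.2 hxy)
      have a3 := hpos c
      positivity
    linarith
  rw [Real.log_mul (hpos _).ne' (hpos _).ne', Real.log_mul (hpos _).ne' (hpos _).ne'] at this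
  linarith

lemma Rr_continuous (c : ℝ) : Continuous (Rr c) := by
  unfold Rr
  have hpos := Real.cosh_pos
  refine Continuous.div_const (Continuous.sub ?_ ?_) _
  · exact Continuous.log (by fun_prop) fun x => (hpos _).ne'
  · exact Continuous.log (by fun_prop) fun x => (hpos _).ne'

lemma th_eq (β ε h lam : ℝ) : th β ε h lam = β * h + Rr (β * ε) lam := rfl

lemma th_neg (β ε h lam : ℝ) : th β ε (-h) (-lam) = - th β ε h lam := by
  rw [th_eq, th_eq, Rr_neg]; ring

def Ll (c t : ℝ) : ℝ := Real.arsinh (Real.tanh t * Real.sinh (2 * c)) / 2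

lemma Ll_strictMono {c : ℝ} (hc : 0 < c) : StrictMono (Ll c) := by
  intro x y hxy
  unfold Ll
  have hs : 0 < Real.sinh (2 * c) := Real.sinh_pos_iff.2 (by positivity)
  have := Real.arsinh_strictMono (mul_lt_mul_of_pos_right (tanh_strictMono' hxy) hs)
  linarith

lemma Ll_continuous (c : ℝ) : Continuous (Ll c) := by
  unfold Ll
  exact (Continuous.arsinh (tanh_continuous'.mul continuous_const)).div_const _

lemma Ll_zero (c : ℝ) : Ll c 0 = 0 := by simp [Ll]

lemma Ll_spec (c t lam : ℝ) :
    Real.sinh (2 * lam) = - (Real.tanh t * Real.sinh (2 * c)) ↔ lam = -Ll c t := by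
  have h : - (Real.tanh t * Real.sinh (2 * c)) = Real.sinh (2 * (-Ll c t)) := by
    rw [show 2 * (-Ll c t) = -Real.arsinh (Real.tanh t * Real.sinh (2 * c)) by unfold Ll; ring,
      Real.sinh_neg, Real.sinh_arsinh]
  rw [h, Real.sinh_inj]
  constructor <;> intro h <;> linarith

def Hh (β ε ts t : ℝ) : ℝ :=
  (min (t - ts) 0 + kf β (max t ts) + Rr (β * ε) (Ll (β * ε) t)) / β

lemma Hh_continuous (β ε ts : ℝ) : Continuous (Hh β ε ts) := by
  unfold Hh
  have h1 := kf_continuous β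
  have h2 := (Rr_continuous (β * ε)).comp (Ll_continuous (β * ε))
  refine Continuous.div_const (Continuous.add (Continuous.add (by fun_prop) ?_) h2) _
  exact h1.comp (by fun_prop)

lemma kf_mono {β ts : ℝ} (hβ : 0 < β) (hts : 0 ≤ ts) (hk : kf β ts = 0)
    (h1 : ∀ t, ts < t → 0 < kf β t) : MonotoneOn (kf β) (Set.Ici ts) := by
  intro x hx y hy hxy
  rcases hxy.eq_or_lt with rfl | hxy
  · exact le_rfl
  rcases (Set.mem_Ici.1 hx).eq_or_lt with rfl | hx
  · rw [hk]; exact (h1 _ hxy).le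
  · exact (kf_lt (hts.trans_lt hx) hxy hβ (h1 _ hx).le).le

lemma Hh_strictMono {β ε ts : ℝ} (hβ : 0 < β) (hε : 0 < ε) (hts : 0 ≤ ts) (hk : kf β ts = 0)
    (h1 : ∀ t, ts < t → 0 < kf β t) : StrictMono (Hh β ε ts) := by
  intro x y hxy
  unfold Hh
  refine div_lt_div_of_pos_right ?_ hβ
  have hc : 0 < β * ε := by positivity
  have a1 := (Rr_strictMono hc) (Ll_strictMono hc hxy)
  have a2 : kf β (max x ts) ≤ kf β (max y ts) :=
    kf_mono hβ hts hk h1 (Set.mem_Ici.2 (le_max_right _ _)) (Set.mem_Ici.2 (le_max_right _ _))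
      (max_le_max_right _ hxy.le)
  have a3 : min (x - ts) 0 ≤ min (y - ts) 0 := min_le_min_right _ (by linarith)
  linarith

lemma Hh_surjective {β ε ts : ℝ} (hβ : 0 < β) (hε : 0 < ε) (hts : 0 ≤ ts) (hk : kf β ts = 0) :
    Function.Surjective (Hh β ε ts) := by
  have hc : 0 < β * ε := by positivity
  have hR : StrictMono (fun t => Rr (β * ε) (Ll (β * ε) t)) :=
    (Rr_strictMono hc).comp (Ll_strictMono hc)
  have hR0 : Rr (β * ε) (Ll (β * ε) 0) = 0 := by rw [Ll_zero, Rr_zero]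
  refine (Hh_continuous β ε ts).surjective ?_ ?_
  · refine tendsto_atTop_mono' _ (f₁ := fun t => (t - β) / β) ?_ ?_
    · filter_upwards [eventually_ge_atTop ts] with t ht
      unfold Hh
      rw [max_eq_left ht, min_eq_right (by linarith)]
      have a1 := hR.monotone (hts.trans ht)
      have a2 := kf_ge hβ t
      simp only [hR0] at a1
      exact div_le_div_of_nonneg_right (by linarith) hβ.le
    · exact (tendsto_atTop_add_const_right _ (-β) tendsto_id).atTop_div_const hβ
  · refine tendsto_atBot_mono' _ (f₁ := fun t => (t - ts) / β) ?_ ?_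
    · filter_upwards [eventually_le_atBot 0] with t ht
      unfold Hh
      rw [max_eq_right (by linarith), min_eq_left (by linarith), hk]
      have a1 := hR.monotone ht
      simp only [hR0] at a1
      exact div_le_div_of_nonneg_right (by linarith) hβ.le
    · exact (tendsto_atBot_add_const_right _ (-ts) tendsto_id).atBot_div_const hβ

lemma Hh_of_ge {β ε ts t : ℝ} (hβ : 0 < β) (ht : ts ≤ t) :
    β * Hh β ε ts t = kf β t + Rr (β * ε) (Ll (β * ε) t) := by
  unfold Hh
  rw [max_eq_left ht, min_eq_right (by linarith), mul_div_cancel₀ _ hβ.ne', zero_add]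

lemma neutral_pos_iff {β ε ts h lam : ℝ} (hβ : 0 < β) (hts : 0 ≤ ts) (hk : kf β ts = 0)
    (h1 : ∀ t, ts < t → 0 < kf β t) (h2 : ∀ t, 0 < t → t < ts → kf β t < 0) :
    (IsNeutral β ε h lam ∧ 0 < th β ε h lam) ↔
      ∃ t, ts < t ∧ h = Hh β ε ts t ∧ lam = -Ll (β * ε) t := by
  have main : ∀ t0, 0 < t0 → 0 < th β ε h lam → kf β t0 = th β ε h lam →
      (IsNeutral β ε h lam ↔ lam = -Ll (β * ε) t0) := by
    intro t0 ht0 hθ hk0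
    rw [← Ll_spec]
    refine neutral_unique hβ hθ.le hk0 (fun t ht => ?_) (fun t ht ht' => ?_) (Or.inl hθ)
    · have := kf_lt ht0 ht hβ (by linarith)
      linarith
    · by_cases hc : 0 ≤ kf β t
      · have := kf_lt ht ht' hβ hc
        linarith
      · linarith
  constructor
  · rintro ⟨hn, hθ⟩
    obtain ⟨t0, ht0, hk0⟩ := exists_t0 hβ hθ
    have hlt : ts < t0 := by
      by_contra hc
      rcases (not_lt.1 hc).eq_or_lt with h | h
      · rw [h, hk] at hk0; linarith
      · have := h2 t0 ht0 h
        linarith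
    have hlam := (main t0 ht0 hθ hk0).1 hn
    refine ⟨t0, hlt, ?_, hlam⟩
    have e1 := Hh_of_ge (ε := ε) hβ hlt.le
    rw [th_eq, hlam, Rr_neg] at hk0
    have : β * h = β * Hh β ε ts t0 := by linarith
    exact mul_left_cancel₀ hβ.ne' this
  · rintro ⟨t, ht, hh, hlam⟩
    have e1 := Hh_of_ge (ε := ε) hβ ht.le
    have hkt : kf β t = th β ε h lam := by
      rw [th_eq, hlam, Rr_neg, hh, e1]; ring
    have hθ : 0 < th β ε h lam := by rw [← hkt]; exact h1 t ht
    exact ⟨(main t (hts.trans_lt ht) hθ hkt).2 hlam, hθ⟩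

lemma neutral_zero_iff {β ε ts h lam : ℝ} (hβ : 0 < β) (hε : 0 < ε) (hts : 0 ≤ ts)
    (hk : kf β ts = 0) (hts1 : β ≤ 1 → ts = 0) (hts2 : 1 < β → 0 < ts)
    (h1 : ∀ t, ts < t → 0 < kf β t) (h2 : ∀ t, 0 < t → t < ts → kf β t < 0) :
    (IsNeutral β ε h lam ∧ th β ε h lam = 0) ↔ (β ≤ 1 ∧ h = 0 ∧ lam = 0) := by
  have main : β ≤ 1 → th β ε h lam = 0 → (IsNeutral β ε h lam ↔ lam = 0) := by
    intro hb hθ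
    have hts0 := hts1 hb
    subst hts0
    rw [neutral_unique hβ hθ.ge (by rw [hk, hθ]) (by rw [hθ]; exact h1) (by rw [hθ]; exact h2)
      (Or.inr rfl), Ll_spec, Ll_zero, neg_zero]
  constructor
  · rintro ⟨hn, hθ⟩
    rcases le_or_gt β 1 with hb | hb
    · have hl := (main hb hθ).1 hn
      refine ⟨hb, ?_, hl⟩
      rw [th_eq, hl, Rr_zero, add_zero] at hθ
      exact (mul_eq_zero.1 hθ).resolve_left hβ.ne'
    · exact absurd hn (not_neutral_sym hβ hε hθ (hts2 hb) hk h1 h2)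
  · rintro ⟨hb, rfl, rfl⟩
    have hθ : th β ε 0 0 = 0 := by rw [th_eq, Rr_zero]; ring
    exact ⟨(main hb hθ).2 rfl, hθ⟩

lemma neutral_iff {β ε ts h lam : ℝ} (hβ : 0 < β) (hε : 0 < ε) (hts : 0 ≤ ts)
    (hk : kf β ts = 0) (hts1 : β ≤ 1 → ts = 0) (hts2 : 1 < β → 0 < ts)
    (h1 : ∀ t, ts < t → 0 < kf β t) (h2 : ∀ t, 0 < t → t < ts → kf β t < 0) :
    IsNeutral β ε h lam ↔
      (∃ t, ts < t ∧ h = Hh β ε ts t ∧ lam = -Ll (β * ε) t) ∨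
      (∃ t, ts < t ∧ -h = Hh β ε ts t ∧ -lam = -Ll (β * ε) t) ∨
      (β ≤ 1 ∧ h = 0 ∧ lam = 0) := by
  rw [← neutral_pos_iff hβ hts hk h1 h2, ← neutral_pos_iff hβ hts hk h1 h2,
    ← neutral_zero_iff hβ hε hts hk hts1 hts2 h1 h2, neutral_neg_iff, th_neg]
  rcases lt_trichotomy (th β ε h lam) 0 with h | h | h
  · constructor
    · exact fun hn => Or.inr (Or.inl ⟨hn, by linarith⟩)
    · rintro (h | h | h) <;> exact h.1
  · constructor
    · exact fun hn => Or.inr (Or.inr ⟨hn, h⟩)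
    · rintro (h | h | h) <;> exact h.1
  · constructor
    · exact fun hn => Or.inl ⟨hn, h⟩
    · rintro (h | h | h) <;> exact h.1

/-- Structure of the neutral set
`R(β,ε) = {(h₀,λ) : the η-marginal converges to the symmetric i.i.d. distribution}`. -/
theorem stmt1 (β ε : ℝ) (hβ : 0 < β) (hε : 0 < ε) :
    ∃ (a : ℝ) (l : ℝ → ℝ),
      0 ≤ a ∧ (1 < β → 0 < a) ∧ (β ≤ 1 → a = 0) ∧
      ContinuousOn l (Set.Ioi a) ∧ StrictMonoOn l (Set.Ioi a) ∧
      (∀ h₀ ∈ Set.Ioi a, 0 < l h₀) ∧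
      (1 < β →
        {p : ℝ × ℝ | IsNeutral β ε p.1 p.2} =
          ((fun h₀ => (h₀, -l h₀)) '' Set.Ioi a) ∪
            ((fun h₀ => (-h₀, l h₀)) '' Set.Ioi a)) ∧
      (β ≤ 1 →
        {p : ℝ × ℝ | IsNeutral β ε p.1 p.2} =
          ((fun h₀ => (h₀, -l h₀)) '' Set.Ioi a) ∪
            ((fun h₀ => (-h₀, l h₀)) '' Set.Ioi a) ∪ {((0 : ℝ), (0 : ℝ))} ∧
        Tendsto l (nhdsWithin 0 (Set.Ioi 0)) (nhds 0)) ∧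
      (1 < β → ¬ IsPreconnected {p : ℝ × ℝ | IsNeutral β ε p.1 p.2}) ∧
      (β ≤ 1 → IsConnected {p : ℝ × ℝ | IsNeutral β ε p.1 p.2}) := by
  obtain ⟨ts, hts, hk, hts1, hts2, h1, h2⟩ := exists_ts hβ
  have hc : 0 < β * ε := by positivity
  have hHm := Hh_strictMono hβ hε hts hk h1
  have hHs := Hh_surjective hβ hε hts hk
  set e := hHm.orderIsoOfSurjective _ hHs with he
  have heH : ∀ t, e.symm (Hh β ε ts t) = t := fun t =>
    StrictMono.orderIsoOfSurjective_symm_apply_self _ hHm hHs t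
  set l : ℝ → ℝ := fun x => Ll (β * ε) (e.symm x) with hl
  set a := Hh β ε ts ts with ha
  have hlH : ∀ t, l (Hh β ε ts t) = Ll (β * ε) t := fun t => by simp only [hl, heH]
  have hlc : Continuous l := (Ll_continuous _).comp e.symm.continuous
  have hlm : StrictMono l := (Ll_strictMono hc).comp e.symm.strictMono
  have hβa : β * a = Rr (β * ε) (Ll (β * ε) ts) := by
    rw [ha, Hh_of_ge hβ le_rfl, hk, zero_add]
  have hRL : StrictMono (fun t => Rr (β * ε) (Ll (β * ε) t)) :=
    (Rr_strictMono hc).comp (Ll_strictMono hc)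
  have hR0 : Rr (β * ε) (Ll (β * ε) 0) = 0 := by rw [Ll_zero, Rr_zero]
  have ha0 : 0 ≤ a := by
    have := hRL.monotone hts
    simp only [hR0, ← hβa] at this
    exact nonneg_of_mul_nonneg_right this hβ
  have hapos : 1 < β → 0 < a := by
    intro hb
    have := hRL (hts2 hb)
    simp only [hR0, ← hβa] at this
    exact (mul_pos_iff_of_pos_left hβ).1 this
  have hazero : β ≤ 1 → a = 0 := by
    intro hb
    rw [hts1 hb, hR0] at hβa
    exact (mul_eq_zero.1 hβa).resolve_left hβ.ne'
  have hla : 0 ≤ l a := by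
    rw [ha, hlH, ← Ll_zero (β * ε)]
    exact (Ll_strictMono hc).monotone hts
  have hlzero : β ≤ 1 → l 0 = 0 := by
    intro hb
    have h := hlH ts
    rw [← ha, hazero hb, hts1 hb, Ll_zero] at h
    exact h
  have hpar : ∀ h lam : ℝ, (∃ t, ts < t ∧ h = Hh β ε ts t ∧ lam = -Ll (β * ε) t) ↔
      (a < h ∧ lam = -l h) := by
    intro h lam
    constructor
    · rintro ⟨t, ht, rfl, rfl⟩
      exact ⟨hHm ht, by rw [hlH]⟩
    · rintro ⟨hah, rfl⟩
      obtain ⟨t, rfl⟩ := hHs h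
      exact ⟨t, hHm.lt_iff_lt.1 hah, rfl, by rw [hlH]⟩
  have hneu : ∀ p : ℝ × ℝ, IsNeutral β ε p.1 p.2 ↔
      (p ∈ ((fun h₀ => (h₀, -l h₀)) '' Set.Ioi a)) ∨
      (p ∈ ((fun h₀ => (-h₀, l h₀)) '' Set.Ioi a)) ∨ (β ≤ 1 ∧ p = (0, 0)) := by
    rintro ⟨h, lam⟩
    rw [neutral_iff hβ hε hts hk hts1 hts2 h1 h2, hpar, hpar]
    simp only [Set.mem_image, Set.mem_Ioi, Prod.mk.injEq]
    refine or_congr ?_ (or_congr ?_ Iff.rfl)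
    · constructor
      · rintro ⟨x, rfl⟩
        exact ⟨h, x, rfl, rfl⟩
      · rintro ⟨x, hx, rfl, rfl⟩
        exact ⟨hx, rfl⟩
    · constructor
      · rintro ⟨x, hx⟩
        exact ⟨-h, x, neg_neg h, by linarith⟩
      · rintro ⟨x, hx, rfl, rfl⟩
        rw [neg_neg]
        exact ⟨hx, rfl⟩
  have hset1 : 1 < β → {p : ℝ × ℝ | IsNeutral β ε p.1 p.2} =
          ((fun h₀ => (h₀, -l h₀)) '' Set.Ioi a) ∪
            ((fun h₀ => (-h₀, l h₀)) '' Set.Ioi a) := by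
    intro hb
    ext p
    rw [Set.mem_ofPred_eq, hneu p, Set.mem_union]
    have : ¬ β ≤ 1 := not_le.2 hb
    tauto
  have hset2 : β ≤ 1 → {p : ℝ × ℝ | IsNeutral β ε p.1 p.2} =
          ((fun h₀ => (h₀, -l h₀)) '' Set.Ioi a) ∪
            ((fun h₀ => (-h₀, l h₀)) '' Set.Ioi a) ∪ {((0 : ℝ), (0 : ℝ))} := by
    intro hb
    ext p
    rw [Set.mem_ofPred_eq, hneu p, Set.mem_union, Set.mem_union, Set.mem_singleton_iff]
    tauto
  refine ⟨a, l, ha0, hapos, hazero, hlc.continuousOn, hlm.strictMonoOn _, ?_, hset1,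
    fun hb => ⟨hset2 hb, ?_⟩, ?_, ?_⟩
  · intro h hh
    exact hla.trans_lt (hlm hh)
  · have := hlc.tendsto 0
    rw [hlzero hb] at this
    exact this.mono_left nhdsWithin_le_nhds
  · intro hb hpre
    rw [hset1 hb] at hpre
    have hap := hapos hb
    have him := (hpre.image Prod.fst continuous_fst.continuousOn).ordConnected
    have m1 : a + 1 ∈ Prod.fst '' (((fun h₀ => (h₀, -l h₀)) '' Set.Ioi a) ∪
            ((fun h₀ => (-h₀, l h₀)) '' Set.Ioi a)) :=
      ⟨(a + 1, -l (a + 1)), Or.inl ⟨a + 1, by simp, rfl⟩, rfl⟩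
    have m2 : -(a + 1) ∈ Prod.fst '' (((fun h₀ => (h₀, -l h₀)) '' Set.Ioi a) ∪
            ((fun h₀ => (-h₀, l h₀)) '' Set.Ioi a)) :=
      ⟨(-(a + 1), l (a + 1)), Or.inr ⟨a + 1, by simp, rfl⟩, rfl⟩
    obtain ⟨p, hp, hp0⟩ := him.out m2 m1 (show (0 : ℝ) ∈ _ from ⟨by linarith, by linarith⟩)
    rcases hp with ⟨x, hx, rfl⟩ | ⟨x, hx, rfl⟩
    · simp only at hp0
      have := Set.mem_Ioi.1 hx
      linarith
    · simp only at hp0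
      have := Set.mem_Ioi.1 hx
      linarith
  · intro hb
    have ha' := hazero hb
    have hl0 := hlzero hb
    have c1 : IsConnected ((fun h₀ => (h₀, -l h₀)) '' Set.Ici (0 : ℝ)) :=
      isConnected_Ici.image _ (by fun_prop)
    have c2 : IsConnected ((fun h₀ => (-h₀, l h₀)) '' Set.Ici (0 : ℝ)) :=
      isConnected_Ici.image _ (by fun_prop)
    have c3 := IsConnected.union (s := (fun h₀ => (h₀, -l h₀)) '' Set.Ici (0 : ℝ))
      (t := (fun h₀ => (-h₀, l h₀)) '' Set.Ici (0 : ℝ))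
      ⟨((0 : ℝ), (0 : ℝ)), ⟨0, by simp, by simp [hl0]⟩, ⟨0, by simp, by simp [hl0]⟩⟩ c1 c2
    have heq : {p : ℝ × ℝ | IsNeutral β ε p.1 p.2} =
        ((fun h₀ => (h₀, -l h₀)) '' Set.Ici (0 : ℝ)) ∪
          ((fun h₀ => (-h₀, l h₀)) '' Set.Ici (0 : ℝ)) := by
      rw [hset2 hb, ha', ← Set.Ioi_insert, Set.image_insert_eq, Set.image_insert_eq, hl0, neg_zero]
      ext p
      simp only [Set.mem_union, Set.mem_insert_iff, Set.mem_singleton_iff]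
      tauto
    rw [heq]
    exact c3
end
end

section
/- Fix β,ε∈(0,∞) and λ,h₀∈ℝ with ĥ := h₀ + h̄_{β,ε}(λ) = 0. Then the Morita approximant measures converge weakly to the symmetric mixture of two product measures: for every N₀∈ℕ and every (σ̄,η̄)∈{-1,1}^{N₀}×{-1,1}^{N₀}, the probability K̂_{λ;β,ε,h₀,N}(σ_i=σ̄_i and η_i=η̄_i for i=1,…,N₀) converges as N→∞ to (1/2)·∏_{i=1}^{N₀} π_{λ;β,ε,h₀}[m^{CW}(β,0+)](σ̄_i,η̄_i) + (1/2)·∏_{i=1}^{N₀} π_{λ;β,ε,h₀}[m^{CW}(β,0−)](σ̄_i,η̄_i). -/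
open Real Filter MeasureTheory
open scoped Classical BigOperators

noncomputable section

/-- The field-shift function `h̄_{β,ε}(λ)`. -/
def hbar (β ε lam : ℝ) : ℝ :=
  1 / (2 * β) * Real.log (Real.cosh (lam + β * ε) / Real.cosh (lam - β * ε))

/-- The single-site joint kernel `π_{λ;β,ε,h₀}[m](σ₁,η₁)`. -/
def piK (β ε h₀ lam m : ℝ) (s t : Bool) : ℝ :=
  Real.exp (β * (m + ε * spin t + h₀) * spin s + lam * spin t) /
    (2 * (Real.cosh (β * (m + ε + h₀)) * Real.exp lam
        + Real.cosh (β * (m - ε + h₀)) * Real.exp (-lam)))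

/-- Probability under the Morita approximant measure that the first `N₀` spins and
random fields agree with `(σbar, ηbar)`. -/
def pairCylProb (N₀ N : ℕ) (β ε h₀ lam : ℝ) (σbar ηbar : Fin N₀ → Bool) : ℝ :=
  ∑ σ : Fin N → Bool, ∑ η : Fin N → Bool,
    if ∀ (i : Fin N₀) (h : (i : ℕ) < N), σ ⟨i, h⟩ = σbar i ∧ η ⟨i, h⟩ = ηbar i
    then morK N β ε h₀ lam σ η else 0


/-- gaussian integral, integrability part -/
lemma gauss_int (b S : ℝ) (hb : 0 < b) :
    Integrable (fun m : ℝ => Real.exp (-b * m ^ 2 / 2 + m * S)) := by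
  have h := ((integrable_exp_neg_mul_sq (b := b / 2) (by positivity)).comp_sub_right (S / b)).const_mul
    (Real.exp (S ^ 2 / (2 * b)))
  refine h.congr (ae_of_all _ fun m => ?_)
  simp only [← Real.exp_add]
  congr 1
  field_simp
  ring

lemma gauss_val (b S : ℝ) (hb : 0 < b) :
    ∫ m : ℝ, Real.exp (-b * m ^ 2 / 2 + m * S) = Real.exp (S ^ 2 / (2 * b)) * √(2 * π / b) := by
  have : (fun m : ℝ => Real.exp (-b * m ^ 2 / 2 + m * S)) =
      fun m => Real.exp (S ^ 2 / (2 * b)) * Real.exp (-(b / 2) * (m - S / b) ^ 2) := by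
    funext m
    simp only [← Real.exp_add]
    congr 1
    field_simp
    ring
  rw [this, integral_const_mul,
    integral_sub_right_eq_self (fun x : ℝ => Real.exp (-(b / 2) * x ^ 2)) (S / b), integral_gaussian]
  congr 2
  field_simp

/-- concentration -/
lemma laplace_s3 (Φ G : ℝ → ℝ) (x0 L B : ℝ) (hΦc : Continuous Φ) (hΦ0 : ∀ x, 0 < Φ x)
    (hΦi : Integrable Φ) (hM : ∀ x, Φ x ≤ Φ x0) (hGc : Continuous G) (hB : ∀ x, |G x| ≤ B)
    (hconc : ∀ e > 0, ∃ q, 0 ≤ q ∧ q < Φ x0 ∧ ∀ x, q < Φ x → |G x - L| ≤ e) :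
    Tendsto (fun N : ℕ => (∫ x, Φ x ^ N * G x) / ∫ x, Φ x ^ N) atTop (nhds L) := by
  have hpi : ∀ N : ℕ, Integrable (fun x => Φ x ^ (N + 1)) := by
    intro N
    refine (hΦi.const_mul (Φ x0 ^ N)).mono' (by fun_prop) (ae_of_all _ fun x => ?_)
    have := pow_le_pow_left₀ (hΦ0 x).le (hM x) N
    rw [Real.norm_of_nonneg (pow_pos (hΦ0 x) _).le, pow_succ]
    exact mul_le_mul_of_nonneg_right this (hΦ0 x).le
  have hpos : ∀ N : ℕ, 0 < ∫ x, Φ x ^ (N + 1) := fun N =>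
    integral_pos_of_integrable_nonneg_nonzero (hΦc.pow (N + 1)) (hpi N)
      (fun x => (pow_pos (hΦ0 x) _).le) (x := x0) (pow_pos (hΦ0 x0) _).ne'
  have hGi : ∀ N : ℕ, Integrable (fun x => Φ x ^ (N + 1) * G x) := fun N =>
    (hpi N).mul_bdd (c := B) (by fun_prop) (ae_of_all _ fun x => hB x)
  rw [← tendsto_add_atTop_iff_nat 1]
  rw [Metric.tendsto_atTop]
  intro e he
  obtain ⟨q, hq0, hq, hc⟩ := hconc (e / 2) (by positivity)
  obtain ⟨r, hqr, hr⟩ := exists_between hq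
  have hr0 : 0 < r := hq0.trans_lt hqr
  have hci : Integrable (fun x => max (Φ x - r) 0) := by
    refine hΦi.mono' (by fun_prop) (ae_of_all _ fun x => ?_)
    rw [Real.norm_of_nonneg (le_max_right _ _)]
    exact max_le (by linarith) (hΦ0 x).le
  have hcpos : 0 < ∫ x, max (Φ x - r) 0 :=
    integral_pos_of_integrable_nonneg_nonzero (by fun_prop) hci
      (fun x => le_max_right _ _) (x := x0) (by
        have : 0 < max (Φ x0 - r) 0 := lt_max_of_lt_left (by linarith)
        exact this.ne')
  set c := ∫ x, max (Φ x - r) 0 with hcdef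
  set J := ∫ x, Φ x with hJ
  have hlow : ∀ N : ℕ, r ^ N * c ≤ ∫ x, Φ x ^ (N + 1) := by
    intro N
    rw [hcdef, ← integral_const_mul]
    refine integral_mono (hci.const_mul _) (hpi N) fun x => ?_
    change r ^ N * max (Φ x - r) 0 ≤ Φ x ^ (N + 1)
    rcases le_total (Φ x) r with h | h
    · rw [max_eq_right (by linarith), mul_zero]; exact (pow_pos (hΦ0 x) _).le
    · rw [max_eq_left (by linarith), pow_succ]
      exact mul_le_mul (pow_le_pow_left₀ hr0.le h N) (by linarith) (by linarith)
        (pow_pos (hΦ0 x) _).le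
  have hB0 : 0 ≤ B := (abs_nonneg _).trans (hB x0)
  have hup : ∀ N : ℕ, |(∫ x, Φ x ^ (N + 1) * G x) - L * ∫ x, Φ x ^ (N + 1)| ≤
      e / 2 * (∫ x, Φ x ^ (N + 1)) + (B + |L|) * q ^ N * J := by
    intro N
    rw [← integral_const_mul, ← integral_sub (hGi N) ((hpi N).const_mul _), hJ,
      ← integral_const_mul, ← integral_const_mul,
      ← integral_add ((hpi N).const_mul _) (hΦi.const_mul _)]
    rw [← Real.norm_eq_abs]
    refine norm_integral_le_of_norm_le (((hpi N).const_mul _).add (hΦi.const_mul _))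
      (ae_of_all _ fun x => ?_)
    change |Φ x ^ (N + 1) * G x - L * Φ x ^ (N + 1)| ≤
      e / 2 * Φ x ^ (N + 1) + (B + |L|) * q ^ N * Φ x
    rw [show Φ x ^ (N + 1) * G x - L * Φ x ^ (N + 1) = Φ x ^ (N + 1) * (G x - L) by ring, abs_mul,
      abs_of_pos (pow_pos (hΦ0 x) _)]
    have hp := pow_pos (hΦ0 x) (N + 1)
    have hBL : 0 ≤ B + |L| := by positivity
    rcases le_or_gt (Φ x) q with h | h
    · have h1 : Φ x ^ (N + 1) ≤ q ^ N * Φ x := by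
        rw [pow_succ]
        exact mul_le_mul_of_nonneg_right (pow_le_pow_left₀ (hΦ0 x).le h N) (hΦ0 x).le
      have h2 : |G x - L| ≤ B + |L| := (abs_sub _ _).trans (by linarith [hB x])
      have h3 := mul_le_mul h1 h2 (abs_nonneg _) (by have := (hΦ0 x).le; positivity)
      have : 0 ≤ e / 2 * Φ x ^ (N + 1) := by positivity
      linarith
    · have h1 := mul_le_mul_of_nonneg_left (hc x h) hp.le
      have : 0 ≤ (B + |L|) * q ^ N * Φ x := by have := (hΦ0 x).le; positivity
      linarith
  have hgeo : Tendsto (fun N : ℕ => (B + |L|) * J / c * (q / r) ^ N) atTop (nhds 0) := by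
    have := (tendsto_pow_atTop_nhds_zero_of_lt_one (r := q / r) (by positivity)
      ((div_lt_one hr0).2 hqr)).const_mul ((B + |L|) * J / c)
    simpa using this
  obtain ⟨N0, hN0⟩ := eventually_atTop.1 (hgeo.eventually_lt_const (half_pos he))
  refine ⟨N0, fun N hN => ?_⟩
  have h1 := hN0 N hN
  have hI := hpos N
  have hu := hup N
  have hl := hlow N
  rw [Real.dist_eq]
  set I := ∫ x, Φ x ^ (N + 1) with hIdef
  rw [show (∫ x, Φ x ^ (N + 1) * G x) / I - L = ((∫ x, Φ x ^ (N + 1) * G x) - L * I) / I by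
    field_simp, abs_div, abs_of_pos hI, div_lt_iff₀ hI]
  have h2 : (B + |L|) * q ^ N * J = ((B + |L|) * J / c * (q / r) ^ N) * (r ^ N * c) := by
    rw [div_pow]; field_simp
  have h3 : ((B + |L|) * J / c * (q / r) ^ N) * (r ^ N * c) < e / 2 * (r ^ N * c) :=
    mul_lt_mul_of_pos_right h1 (by positivity)
  nlinarith

def Phi (β m : ℝ) : ℝ := Real.exp (-β * m ^ 2 / 2) * Real.cosh (β * m)

lemma Phi_eq (β m : ℝ) : Phi β m =
    (Real.exp (-β * m ^ 2 / 2 + m * β) + Real.exp (-β * m ^ 2 / 2 + m * (-β))) / 2 := by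
  rw [Phi, Real.cosh_eq, Real.exp_add, Real.exp_add]
  ring_nf

lemma Phi_cont (β : ℝ) : Continuous (Phi β) := by
  unfold Phi; fun_prop

lemma Phi_pos (β m : ℝ) : 0 < Phi β m := mul_pos (Real.exp_pos _) (Real.cosh_pos _)

lemma Phi_integrable (β : ℝ) (hβ : 0 < β) : Integrable (Phi β) := by
  refine (((gauss_int β β hβ).add (gauss_int β (-β) hβ)).div_const 2).congr (ae_of_all _ fun m => ?_)
  exact (Phi_eq β m).symm

lemma Phi_neg (β m : ℝ) : Phi β (-m) = Phi β m := by
  simp [Phi]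

lemma gauss_tendsto (β a : ℝ) (hβ : 0 < β) :
    Tendsto (fun m : ℝ => Real.exp (-(β / 2) * (m - a) ^ 2)) (cocompact ℝ) (nhds 0) := by
  have h := tendsto_rpow_abs_mul_exp_neg_mul_sq_cocompact (a := β / 2) (by positivity) 0
  have h2 := (Homeomorph.subRight a).isClosedEmbedding.tendsto_cocompact
  refine (h.comp h2).congr fun m => ?_
  simp

lemma Phi_tendsto (β : ℝ) (hβ : 0 < β) : Tendsto (Phi β) (cocompact ℝ) (nhds 0) := by
  have h := ((gauss_tendsto β 1 hβ).add (gauss_tendsto β (-1) hβ)).const_mul (Real.exp (β / 2) / 2)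
  simp only [add_zero, mul_zero] at h
  refine h.congr fun m => ?_
  rw [Phi_eq, div_mul_eq_mul_div, mul_add, ← Real.exp_add, ← Real.exp_add]
  ring_nf

lemma hasDeriv_tanh (x : ℝ) : HasDerivAt Real.tanh (1 / Real.cosh x ^ 2) x := by
  have h := (Real.hasDerivAt_sinh x).div (Real.hasDerivAt_cosh x) (Real.cosh_pos x).ne'
  have e : Real.tanh = Real.sinh / Real.cosh := by
    funext y; simp [Real.tanh_eq_sinh_div_cosh]
  rw [e]
  refine h.congr_deriv ?_
  rw [← Real.cosh_sq_sub_sinh_sq x]; ring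

lemma Phi_deriv (β m : ℝ) : HasDerivAt (Phi β) (Phi β m * β * (Real.tanh (β * m) - m)) m := by
  have h1 : HasDerivAt (fun m : ℝ => Real.exp (-β * m ^ 2 / 2))
      (Real.exp (-β * m ^ 2 / 2) * (-β * m)) m := by
    convert (((hasDerivAt_pow 2 m).const_mul (-β)).div_const 2).exp using 1
    push_cast; ring
  have h2 : HasDerivAt (fun m : ℝ => Real.cosh (β * m)) (Real.sinh (β * m) * β) m := by
    refine ((hasDerivAt_id m).const_mul β).cosh.congr_deriv ?_
    simp
  refine (h1.mul h2).congr_deriv ?_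
  rw [Phi, Real.tanh_eq_sinh_div_cosh]
  have := (Real.cosh_pos (β * m)).ne'
  field_simp
  ring

lemma tanh_gt (β mp x : ℝ) (hβ : 0 < β) (hmp : mp = Real.tanh (β * mp)) (h0 : 0 < x) (h1 : x < mp) :
    0 < Real.tanh (β * x) - x := by
  have hd : ∀ y, HasDerivAt (fun y => Real.tanh (β * y) - y) (β / Real.cosh (β * y) ^ 2 - 1) y := by
    intro y
    refine (((hasDeriv_tanh (β * y)).comp y ((hasDerivAt_id y).const_mul β)).sub
      (hasDerivAt_id y)).congr_deriv ?_
    simp; ring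
  have hconc : StrictConcaveOn ℝ (Set.Ici 0) (fun y => Real.tanh (β * y) - y) := by
    apply StrictAntiOn.strictConcaveOn_of_deriv (convex_Ici 0)
    · exact fun y _ => (hd y).continuousAt.continuousWithinAt
    · intro a ha b hb hab
      rw [interior_Ici] at ha hb
      rw [(hd a).deriv, (hd b).deriv]
      have : Real.cosh (β * a) < Real.cosh (β * b) := by
        rw [Real.cosh_lt_cosh, abs_of_pos (mul_pos hβ ha), abs_of_pos (mul_pos hβ hb)]
        exact mul_lt_mul_of_pos_left hab hβ
      have hp := Real.cosh_pos (β * a)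
      gcongr
  have hmp0 : 0 < mp := h0.trans h1
  have hx1 : 0 < 1 - x / mp := by rw [sub_pos, div_lt_one hmp0]; exact h1
  have hx2 : 0 < x / mp := by positivity
  have := hconc.2 (show (0 : ℝ) ∈ Set.Ici 0 by simp) (show mp ∈ Set.Ici 0 from hmp0.le) hmp0.ne
    hx1 hx2 (by ring)
  simp only [smul_eq_mul, mul_zero, Real.tanh_zero, ← hmp, sub_self, zero_add, add_zero] at this
  rwa [div_mul_cancel₀ _ hmp0.ne'] at this

lemma Phi_max (β mp : ℝ) (hβ : 0 < β) (hmp : mp = Real.tanh (β * mp))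
    (hmax : ∀ m : ℝ, m = Real.tanh (β * m) → m ≤ mp) :
    (∀ x, Phi β x ≤ Phi β mp) ∧ ∀ x, Phi β x = Phi β mp → x = mp ∨ x = -mp := by
  have hmono : StrictMonoOn (Phi β) (Set.Icc 0 mp) := by
    apply strictMonoOn_of_deriv_pos (convex_Icc 0 mp) (Phi_cont β).continuousOn
    intro x hx
    rw [interior_Icc] at hx
    rw [(Phi_deriv β x).deriv]
    exact mul_pos (mul_pos (Phi_pos β x) hβ) (tanh_gt β mp x hβ hmp hx.1 hx.2)
  have hglob : ∀ y, (∀ x, Phi β x ≤ Phi β y) → |y| = mp := by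
    intro y hy
    have hd : Phi β y * β * (Real.tanh (β * y) - y) = 0 :=
      IsLocalMax.hasDerivAt_eq_zero (Filter.Eventually.of_forall hy) (Phi_deriv β y)
    have hy1 : y = Real.tanh (β * y) := by
      have := (mul_pos (Phi_pos β y) hβ).ne'
      rcases mul_eq_zero.1 hd with h | h
      · exact absurd h this
      · linarith
    have hy2 : |y| = Real.tanh (β * |y|) := by
      rcases abs_choice y with h | h <;> rw [h]
      · exact hy1
      · rw [mul_neg, Real.tanh_neg, ← hy1]
    refine le_antisymm (hmax _ hy2) ?_
    by_contra hlt
    push Not at hlt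
    have h0 := abs_nonneg y
    have h1 := hmono ⟨h0, hlt.le⟩ ⟨h0.trans hlt.le, le_rfl⟩ hlt
    have h2 : Phi β |y| = Phi β y := by
      rcases abs_choice y with h | h <;> rw [h]
      exact Phi_neg β y
    linarith [hy mp]
  obtain ⟨y, hy⟩ := (Phi_cont β).exists_forall_ge' (x₀ := 0)
    (((Phi_tendsto β hβ).eventually_lt_const (Phi_pos β 0)).mono fun x hx => hx.le)
  have e : Phi β y = Phi β mp := by
    rw [← hglob y hy]
    rcases abs_choice y with h | h <;> rw [h]
    exact (Phi_neg β y).symm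
  refine ⟨fun x => e ▸ hy x, fun x hx => ?_⟩
  have := hglob x (fun z => by rw [hx, ← e]; exact hy z)
  rcases abs_choice x with h | h
  · left; linarith
  · right; linarith

lemma Phi_conc (β mp : ℝ) (hβ : 0 < β) (hmp : mp = Real.tanh (β * mp))
    (hmax : ∀ m : ℝ, m = Real.tanh (β * m) → m ≤ mp) (G : ℝ → ℝ) (hG : Continuous G) (L : ℝ)
    (h1 : G mp = L) (h2 : G (-mp) = L) :
    ∀ e > 0, ∃ q, 0 ≤ q ∧ q < Phi β mp ∧ ∀ x, q < Phi β x → |G x - L| ≤ e := by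
  intro e he
  obtain ⟨hm, hu⟩ := Phi_max β mp hβ hmp hmax
  have hM := Phi_pos β mp
  obtain ⟨K, hK, hKs⟩ := mem_cocompact.1
    ((Phi_tendsto β hβ).eventually_lt_const (half_pos hM))
  have hS : IsCompact (K ∩ {x | e ≤ |G x - L|}) :=
    hK.inter_right (isClosed_le continuous_const (by fun_prop))
  rcases (K ∩ {x | e ≤ |G x - L|}).eq_empty_or_nonempty with hE | hne
  · refine ⟨Phi β mp / 2, by positivity, by linarith, fun x hx => ?_⟩
    by_contra hlt
    push Not at hlt
    have hxK : x ∈ K := by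
      by_contra hx'
      have : Phi β x < Phi β mp / 2 := hKs hx'
      linarith
    have : x ∈ K ∩ {x | e ≤ |G x - L|} := ⟨hxK, hlt.le⟩
    rw [hE] at this
    exact this
  · obtain ⟨y, hyS, hy⟩ := hS.exists_isMaxOn hne (Phi_cont β).continuousOn
    have hylt : Phi β y < Phi β mp := by
      refine lt_of_le_of_ne (hm y) fun h => ?_
      have h3 : e ≤ |G y - L| := hyS.2
      have : G y = L := by rcases hu y h with h | h <;> rw [h] <;> assumption
      rw [this] at h3
      simp at h3
      linarith
    refine ⟨max (Phi β mp / 2) (Phi β y), by positivity, max_lt (by linarith) hylt, fun x hx => ?_⟩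
    by_contra hlt
    push Not at hlt
    have hxK : x ∈ K := by
      by_contra hx'
      have : Phi β x < Phi β mp / 2 := hKs hx'
      linarith [le_max_left (Phi β mp / 2) (Phi β y)]
    have : Phi β x ≤ Phi β y := hy (show x ∈ K ∩ {x | e ≤ |G x - L|} from ⟨hxK, hlt.le⟩)
    linarith [le_max_right (Phi β mp / 2) (Phi β y)]

def wt (β ε h₀ lam m : ℝ) (s t : Bool) : ℝ :=
  Real.exp (β * (m + ε * spin t + h₀) * spin s + lam * spin t)

def Wt (β ε h₀ lam m : ℝ) : ℝ :=
  2 * (Real.cosh (β * (m + ε + h₀)) * Real.exp lam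
        + Real.cosh (β * (m - ε + h₀)) * Real.exp (-lam))

lemma piK_eq (β ε h₀ lam m : ℝ) (s t : Bool) :
    piK β ε h₀ lam m s t = wt β ε h₀ lam m s t / Wt β ε h₀ lam m := rfl

lemma sum_wt (β ε h₀ lam m : ℝ) :
    ∑ s : Bool, ∑ t : Bool, wt β ε h₀ lam m s t = Wt β ε h₀ lam m := by
  simp only [Fintype.sum_bool, wt, Wt, spin, Real.cosh_eq, Real.exp_add]
  simp
  ring_nf

lemma Wt_pos (β ε h₀ lam m : ℝ) : 0 < Wt β ε h₀ lam m := by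
  unfold Wt
  have := Real.cosh_pos (β * (m + ε + h₀))
  have := Real.cosh_pos (β * (m - ε + h₀))
  positivity

lemma Wt_eq (β ε h₀ lam : ℝ) (hβ : 0 < β) (hh : h₀ + hbar β ε lam = 0) :
    ∃ C > 0, ∀ m, Wt β ε h₀ lam m = C * Real.cosh (β * m) := by
  have hA := Real.cosh_pos (lam + β * ε)
  have hB := Real.cosh_pos (lam - β * ε)
  have key : Real.exp (β * h₀) * Real.cosh (lam + β * ε) =
      Real.exp (-(β * h₀)) * Real.cosh (lam - β * ε) := by
    have h1 : 2 * β * h₀ = Real.log (Real.cosh (lam - β * ε)) - Real.log (Real.cosh (lam + β * ε)) := by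
      have : h₀ = - hbar β ε lam := by linarith
      rw [this, hbar, Real.log_div hA.ne' hB.ne']
      field_simp
      ring
    have h2 : β * h₀ + Real.log (Real.cosh (lam + β * ε)) =
      -(β * h₀) + Real.log (Real.cosh (lam - β * ε)) := by linarith
    have h3 := congrArg Real.exp h2
    rwa [Real.exp_add, Real.exp_add, Real.exp_log hA, Real.exp_log hB] at h3
  refine ⟨4 * (Real.exp (β * h₀) * Real.cosh (lam + β * ε)), by positivity, fun m => ?_⟩
  have e1 : Wt β ε h₀ lam m = 2 * (Real.exp (β * m) * (Real.exp (β * h₀) * Real.cosh (lam + β * ε)) +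
      Real.exp (-(β * m)) * (Real.exp (-(β * h₀)) * Real.cosh (lam - β * ε))) := by
    unfold Wt
    rw [Real.cosh_eq, Real.cosh_eq, Real.cosh_eq, Real.cosh_eq]
    simp only [mul_add, mul_sub, add_div, add_mul, sub_eq_add_neg, neg_add, Real.exp_add, neg_neg]
    ring_nf
  rw [e1, ← key, Real.cosh_eq (β * m)]
  ring

lemma sum_sum_prod (N : ℕ) (F : Fin N → Bool → Bool → ℝ) :
    ∑ σ : Fin N → Bool, ∑ η : Fin N → Bool, ∏ i, F i (σ i) (η i) =
      ∏ i, ∑ s : Bool, ∑ t : Bool, F i s t := by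
  rw [Fintype.prod_sum]
  refine Finset.sum_congr rfl fun σ _ => ?_
  rw [Fintype.prod_sum]

lemma hs (N : ℕ) (hN : 0 < N) (β ε h₀ lam : ℝ) (hβ : 0 < β) (σ η : Fin N → Bool) :
    Integrable (fun m : ℝ => Real.exp (-(N * β) * m ^ 2 / 2) * ∏ i, wt β ε h₀ lam m (σ i) (η i)) ∧
    ∫ m : ℝ, Real.exp (-(N * β) * m ^ 2 / 2) * ∏ i, wt β ε h₀ lam m (σ i) (η i) =
      √(2 * π / (N * β)) * Real.exp (morH N β ε h₀ lam σ η) := by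
  have hN' : (0 : ℝ) < N := by exact_mod_cast hN
  have hb : 0 < N * β := by positivity
  have e : (fun m : ℝ => Real.exp (-(N * β) * m ^ 2 / 2) * ∏ i, wt β ε h₀ lam m (σ i) (η i)) =
      fun m => Real.exp (β * ∑ i, (ε * spin (η i) + h₀) * spin (σ i) + lam * ∑ i, spin (η i)) *
        Real.exp (-(N * β) * m ^ 2 / 2 + m * (β * ∑ i, spin (σ i))) := by
    funext m
    simp only [wt]
    rw [← Real.exp_sum, ← Real.exp_add, ← Real.exp_add]
    congr 1
    rw [Finset.mul_sum, Finset.mul_sum, Finset.mul_sum, Finset.mul_sum]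
    rw [← Finset.sum_add_distrib, add_left_comm, ← Finset.sum_add_distrib]
    congr 1
    refine Finset.sum_congr rfl fun i _ => ?_
    ring
  rw [e]
  refine ⟨(gauss_int _ _ hb).const_mul _, ?_⟩
  rw [integral_const_mul, gauss_val _ _ hb, ← mul_assoc, ← Real.exp_add, mul_comm]
  congr 2
  unfold morH
  field_simp
  ring

lemma num_eq (N₀ k : ℕ) (hN : 0 < N₀ + k) (β ε h₀ lam : ℝ) (hβ : 0 < β) (σbar ηbar : Fin N₀ → Bool) :
    √(2 * π / ((N₀ + k : ℕ) * β)) * (∑ σ : Fin (N₀ + k) → Bool, ∑ η : Fin (N₀ + k) → Bool,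
      if ∀ (i : Fin N₀) (h : (i : ℕ) < N₀ + k), σ ⟨i, h⟩ = σbar i ∧ η ⟨i, h⟩ = ηbar i
      then Real.exp (morH (N₀ + k) β ε h₀ lam σ η) else 0) =
    ∫ m : ℝ, Real.exp (-((N₀ + k : ℕ) * β) * m ^ 2 / 2) *
      ((∏ i, piK β ε h₀ lam m (σbar i) (ηbar i)) * Wt β ε h₀ lam m ^ (N₀ + k)) := by
  set I : (Fin (N₀ + k) → Bool) → (Fin (N₀ + k) → Bool) → ℝ := fun σ η =>
    if ∀ (i : Fin N₀) (h : (i : ℕ) < N₀ + k), σ ⟨i, h⟩ = σbar i ∧ η ⟨i, h⟩ = ηbar i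
      then 1 else 0 with hI
  have key : ∀ m, (∏ i, piK β ε h₀ lam m (σbar i) (ηbar i)) * Wt β ε h₀ lam m ^ (N₀ + k) =
      ∑ σ : Fin (N₀ + k) → Bool, ∑ η : Fin (N₀ + k) → Bool,
        I σ η * ∏ i, wt β ε h₀ lam m (σ i) (η i) := by
    intro m
    set J : Fin (N₀ + k) → Bool → Bool → ℝ :=
      Fin.addCases (fun i s t => if s = σbar i ∧ t = ηbar i then 1 else 0) (fun _ _ _ => 1) with hJ
    have hIJ : ∀ σ η, I σ η = ∏ i, J i (σ i) (η i) := by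
      intro σ η
      rw [Fin.prod_univ_add]
      simp only [hJ, Fin.addCases_left, Fin.addCases_right, Finset.prod_const_one, mul_one]
      rw [Finset.prod_ite_zero]
      simp only [hI, Finset.prod_const_one, Finset.mem_univ, true_implies]
      refine if_congr ⟨fun h i => h i _, fun h i _ => h i⟩ rfl rfl
    simp only [hIJ, ← Finset.prod_mul_distrib]
    rw [sum_sum_prod (N₀ + k) (fun i s t => J i s t * wt β ε h₀ lam m s t), Fin.prod_univ_add]
    simp only [hJ, Fin.addCases_left, Fin.addCases_right, one_mul, sum_wt]
    rw [pow_add, ← mul_assoc, Finset.prod_const, Finset.card_univ, Fintype.card_fin]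
    congr 1
    have : Wt β ε h₀ lam m ^ N₀ = ∏ i : Fin N₀, Wt β ε h₀ lam m := by simp
    rw [this, ← Finset.prod_mul_distrib]
    refine Finset.prod_congr rfl fun i _ => ?_
    rw [piK_eq, div_mul_cancel₀ _ (Wt_pos _ _ _ _ _).ne']
    simp only [ite_mul, one_mul, zero_mul, ite_and]
    simp
  simp only [key, Finset.mul_sum]
  have hint : ∀ σ η, Integrable (fun m => Real.exp (-((N₀ + k : ℕ) * β) * m ^ 2 / 2) *
      (I σ η * ∏ i, wt β ε h₀ lam m (σ i) (η i))) := by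
    intro σ η
    refine ((hs (N₀ + k) hN β ε h₀ lam hβ σ η).1.const_mul (I σ η)).congr (ae_of_all _ fun m => ?_)
    simp only []
    ring
  rw [integral_finset_sum _ fun σ _ => integrable_finset_sum _ fun η _ => hint σ η]
  refine Finset.sum_congr rfl fun σ _ => ?_
  rw [integral_finset_sum _ fun η _ => hint σ η]
  refine Finset.sum_congr rfl fun η _ => ?_
  have h2 := (hs (N₀ + k) hN β ε h₀ lam hβ σ η).2
  simp only [mul_left_comm _ (I σ η)]
  rw [integral_const_mul, h2]
  simp only [hI]
  split_ifs <;> simp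

lemma prob_eq (N₀ N : ℕ) (hN : 0 < N) (hle : N₀ ≤ N) (β ε h₀ lam : ℝ) (hβ : 0 < β)
    (hh : h₀ + hbar β ε lam = 0) (σbar ηbar : Fin N₀ → Bool) :
    pairCylProb N₀ N β ε h₀ lam σbar ηbar =
      (∫ m, Phi β m ^ N * ∏ i, piK β ε h₀ lam m (σbar i) (ηbar i)) / ∫ m, Phi β m ^ N := by
  obtain ⟨C, hC, hW⟩ := Wt_eq β ε h₀ lam hβ hh
  have hN' : (0 : ℝ) < N := by exact_mod_cast hN
  have hc : 0 < √(2 * π / (N * β)) := by positivity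
  have hphi : ∀ m, Real.exp (-(N * β) * m ^ 2 / 2) * Wt β ε h₀ lam m ^ N = C ^ N * Phi β m ^ N := by
    intro m
    rw [hW, Phi, mul_pow, mul_pow, ← Real.exp_nat_mul]
    rw [show -(N * β) * m ^ 2 / 2 = N * (-β * m ^ 2 / 2) by ring]
    ring
  have hZ : √(2 * π / (N * β)) * morZ N β ε h₀ lam = C ^ N * ∫ m, Phi β m ^ N := by
    obtain ⟨k, rfl⟩ : ∃ k, N = 0 + k := ⟨N, by simp⟩
    have h := num_eq 0 k hN β ε h₀ lam hβ Fin.elim0 Fin.elim0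
    simp only [IsEmpty.forall_iff, if_true, Finset.univ_eq_empty, Finset.prod_empty, one_mul,
      hphi] at h
    rw [integral_const_mul] at h
    exact h
  have hnum : √(2 * π / (N * β)) * (∑ σ : Fin N → Bool, ∑ η : Fin N → Bool,
      if ∀ (i : Fin N₀) (h : (i : ℕ) < N), σ ⟨i, h⟩ = σbar i ∧ η ⟨i, h⟩ = ηbar i
      then Real.exp (morH N β ε h₀ lam σ η) else 0) =
      C ^ N * ∫ m, Phi β m ^ N * ∏ i, piK β ε h₀ lam m (σbar i) (ηbar i) := by
    obtain ⟨k, rfl⟩ := Nat.exists_eq_add_of_le hle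
    rw [num_eq N₀ k hN β ε h₀ lam hβ σbar ηbar, ← integral_const_mul]
    congr 1
    funext m
    rw [mul_left_comm, hphi]
    ring
  have hp : pairCylProb N₀ N β ε h₀ lam σbar ηbar = (∑ σ : Fin N → Bool, ∑ η : Fin N → Bool,
      if ∀ (i : Fin N₀) (h : (i : ℕ) < N), σ ⟨i, h⟩ = σbar i ∧ η ⟨i, h⟩ = ηbar i
      then Real.exp (morH N β ε h₀ lam σ η) else 0) / morZ N β ε h₀ lam := by
    simp only [pairCylProb, morK, Finset.sum_div]
    refine Finset.sum_congr rfl fun σ _ => Finset.sum_congr rfl fun η _ => ?_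
    split_ifs <;> simp
  rw [hp, ← mul_div_mul_left _ _ hc.ne', hZ, hnum, mul_div_mul_left _ _ (pow_pos hC N).ne']

lemma piK_cont (β ε h₀ lam : ℝ) (s t : Bool) : Continuous fun m => piK β ε h₀ lam m s t := by
  have : ∀ m, Wt β ε h₀ lam m ≠ 0 := fun m => (Wt_pos _ _ _ _ _).ne'
  simp only [piK_eq]
  refine Continuous.div ?_ ?_ this
  · unfold wt; fun_prop
  · unfold Wt; fun_prop

lemma piK_bd (β ε h₀ lam m : ℝ) (s t : Bool) :
    0 ≤ piK β ε h₀ lam m s t ∧ piK β ε h₀ lam m s t ≤ 1 := by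
  have hW := Wt_pos β ε h₀ lam m
  have hw : ∀ s t, 0 ≤ wt β ε h₀ lam m s t := fun s t => (Real.exp_pos _).le
  rw [piK_eq]
  refine ⟨div_nonneg (hw s t) hW.le, (div_le_one hW).2 ?_⟩
  rw [← sum_wt]
  exact (Finset.single_le_sum (f := fun t => wt β ε h₀ lam m s t) (fun t _ => hw s t)
    (Finset.mem_univ t)).trans
    (Finset.single_le_sum (f := fun s => ∑ t : Bool, wt β ε h₀ lam m s t)
      (fun s _ => Finset.sum_nonneg fun t _ => hw s t) (Finset.mem_univ s))

/-- For `ĥ = h₀ + h̄_{β,ε}(λ) = 0`, the Morita approximant measures converge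
weakly to the symmetric mixture of the two product measures with single-site marginals
`π_{λ;β,ε,h₀}[±m⁺]`, where `m⁺ = m^{CW}(β,0+)` is the largest solution of `m = tanh(βm)`. -/
theorem stmt3 (β ε lam h₀ mp : ℝ) (hβ : 0 < β) (hε : 0 < ε)
    (hh : h₀ + hbar β ε lam = 0)
    (hmp : mp = Real.tanh (β * mp))
    (hmax : ∀ m : ℝ, m = Real.tanh (β * m) → m ≤ mp) :
    ∀ (N₀ : ℕ) (σbar ηbar : Fin N₀ → Bool),
      Tendsto (fun N => pairCylProb N₀ N β ε h₀ lam σbar ηbar) atTop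
        (nhds ((1 / 2) * ∏ i : Fin N₀, piK β ε h₀ lam mp (σbar i) (ηbar i)
             + (1 / 2) * ∏ i : Fin N₀, piK β ε h₀ lam (-mp) (σbar i) (ηbar i))) := by
  intro N₀ σbar ηbar
  set g : ℝ → ℝ := fun m => ∏ i, piK β ε h₀ lam m (σbar i) (ηbar i) with hg
  have hgc : Continuous g := continuous_finset_prod _ fun i _ => piK_cont _ _ _ _ _ _
  have hg0 : ∀ m, 0 ≤ g m := fun m => Finset.prod_nonneg fun i _ => (piK_bd _ _ _ _ _ _ _).1
  have hg1 : ∀ m, g m ≤ 1 := fun m => Finset.prod_le_one (fun i _ => (piK_bd _ _ _ _ _ _ _).1)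
    fun i _ => (piK_bd _ _ _ _ _ _ _).2
  have hM := (Phi_max β mp hβ hmp hmax).1
  set G : ℝ → ℝ := fun m => (1 / 2) * g m + (1 / 2) * g (-m) with hG
  have hGc : Continuous G := by fun_prop
  have hlim := laplace_s3 (Phi β) G mp (G mp) 1 (Phi_cont β) (Phi_pos β) (Phi_integrable β hβ) hM hGc
    (fun x => by
      rw [abs_le]
      constructor <;> simp only [hG] <;> linarith [hg0 x, hg0 (-x), hg1 x, hg1 (-x)])
    (Phi_conc β mp hβ hmp hmax G hGc _ rfl (by simp only [hG, neg_neg]; ring))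
  refine hlim.congr' ?_
  filter_upwards [eventually_ge_atTop (N₀ + 1)] with N hN
  rw [prob_eq N₀ N (by omega) (by omega) β ε h₀ lam hβ hh σbar ηbar]
  congr 1
  obtain ⟨n, rfl⟩ : ∃ n, N = n + 1 := ⟨N - 1, by omega⟩
  have hi : Integrable (fun x => Phi β x ^ (n + 1) * g x) := by
    have hc := Phi_cont β
    refine ((Phi_integrable β hβ).const_mul (Phi β mp ^ n)).mono' (by fun_prop)
      (ae_of_all _ fun x => ?_)
    have hx := (Phi_pos β x).le
    rw [Real.norm_of_nonneg (mul_nonneg (pow_nonneg hx _) (hg0 x)), pow_succ]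
    calc Phi β x ^ n * Phi β x * g x ≤ Phi β x ^ n * Phi β x * 1 :=
          mul_le_mul_of_nonneg_left (hg1 x) (by positivity)
      _ ≤ Phi β mp ^ n * Phi β x := by
          rw [mul_one]
          exact mul_le_mul_of_nonneg_right (pow_le_pow_left₀ hx (hM x) n) hx
  have hi2 : Integrable (fun x => Phi β x ^ (n + 1) * g (-x)) := by
    have := hi.comp_neg
    simpa only [Phi_neg] using this
  have he : ∫ x, Phi β x ^ (n + 1) * g (-x) = ∫ x, Phi β x ^ (n + 1) * g x := by
    have := integral_neg_eq_self (fun x => Phi β x ^ (n + 1) * g x) volume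
    simpa only [Phi_neg] using this
  have e2 : (fun x => Phi β x ^ (n + 1) * G x) = fun x => (1 / 2) * (Phi β x ^ (n + 1) * g x) +
      (1 / 2) * (Phi β x ^ (n + 1) * g (-x)) := by
    funext x; simp only [hG]; ring
  rw [e2, integral_add (hi.const_mul _) (hi2.const_mul _), integral_const_mul, integral_const_mul, he]
  ring
end
end
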